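/- arXiv:1912.04546 — 2 statements merged into one kernel-verified Lean document; each statement's English description precedes it below -/
import Mathlib

section
/- Let M₁ be a von Neumann algebra on a complex Hilbert space H with a faithful tracial state τ, and let N ⊆ K ⊆ K₁ ⊆ M₁ be von Neumann subalgebras. Assume the τ-preserving conditional expectations onto the relative commutants N'∩K₁, K'∩K₁, N'∩M₁ and K'∩M₁ exist. Then the quadruple with top row K'∩M₁ ⊆ N'∩M₁ and bottom row K'∩K₁ ⊆ N'∩K₁ is a commuting square: for every x ∈ K'∩M₁, E_{N'∩K₁}(x) ∈ K'∩K₁ and E_{N'∩K₁}(x) = E_{K'∩K₁}(x). -/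
open scoped ComplexOrder

section WeakCompactness

open Filter Topology InnerProductSpace

variable {H : Type*} [NormedAddCommGroup H] [InnerProductSpace ℂ H] [CompleteSpace H]

/-- Along an ultrafilter of uniformly bounded operators, the matrix coefficients converge to those
of a bounded operator. -/
theorem Ultrafilter.exists_le_nhds_wot (F : Ultrafilter (H →WOT[ℂ] H)) {r : ℝ}
    (hF : ∀ᶠ A in (F : Filter (H →WOT[ℂ] H)), ‖A.toCLM‖ ≤ r) :
    ∃ T : H →L[ℂ] H, ‖T‖ ≤ r ∧ (F : Filter (H →WOT[ℂ] H)) ≤ 𝓝 (.ofCLM T) := by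
  have hr : 0 ≤ r := by
    obtain ⟨A, hA⟩ := hF.exists
    exact (norm_nonneg _).trans hA
  have hbound : ∀ x y : H, ∀ᶠ A in (F : Filter (H →WOT[ℂ] H)), ‖⟪A x, y⟫_ℂ‖ ≤ r * ‖x‖ * ‖y‖ := by
    intro x y
    filter_upwards [hF] with A hA
    calc ‖⟪A x, y⟫_ℂ‖ ≤ ‖A.toCLM x‖ * ‖y‖ := norm_inner_le_norm _ _
      _ ≤ r * ‖x‖ * ‖y‖ := by gcongr; exact A.toCLM.le_of_opNorm_le hA x
  have hlim : ∀ x y : H, ∃ c : ℂ, Tendsto (fun A : H →WOT[ℂ] H => ⟪A x, y⟫_ℂ) F (𝓝 c) := by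
    intro x y
    have hK : IsCompact (Metric.closedBall (0 : ℂ) (r * ‖x‖ * ‖y‖)) := isCompact_closedBall _ _
    obtain ⟨c, -, hc⟩ := hK.ultrafilter_le_nhds (F.map fun A => ⟪A x, y⟫_ℂ)
      (by
        refine le_principal_iff.2 (Filter.mem_map.2 ?_)
        filter_upwards [hbound x y] with A hA
        simpa using hA)
    exact ⟨c, hc⟩
  choose L hL using hlim
  have hLb : ∀ x y, ‖L x y‖ ≤ r * ‖x‖ * ‖y‖ := fun x y =>
    le_of_tendsto (hL x y).norm (hbound x y)
  let f : H → H →L[ℂ] ℂ := fun x => LinearMap.mkContinuous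
    { toFun := L x
      map_add' := fun y z => tendsto_nhds_unique (hL x (y + z))
        (by simpa only [inner_add_right] using (hL x y).add (hL x z))
      map_smul' := fun c y => tendsto_nhds_unique (hL x (c • y))
        (by simpa only [inner_smul_right, smul_eq_mul, RingHom.id_apply] using (hL x y).const_mul c) }
    (r * ‖x‖) (hLb x)
  let v : H → H := fun x => (InnerProductSpace.toDual ℂ H).symm (f x)
  have hv : ∀ x y, ⟪v x, y⟫_ℂ = L x y := fun x y => InnerProductSpace.toDual_symm_apply
  have hvb : ∀ x, ‖v x‖ ≤ r * ‖x‖ := by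
    intro x
    simp only [v, LinearIsometryEquiv.norm_map]
    exact LinearMap.mkContinuous_norm_le _ (by positivity) _
  let T : H →L[ℂ] H := LinearMap.mkContinuous
    { toFun := v
      map_add' := fun x z => ext_inner_right ℂ fun y => by
        rw [inner_add_left, hv, hv, hv]
        exact tendsto_nhds_unique (hL (x + z) y)
          (by simpa only [map_add, inner_add_left] using (hL x y).add (hL z y))
      map_smul' := fun c x => ext_inner_right ℂ fun y => by
        rw [RingHom.id_apply, inner_smul_left, hv, hv]
        exact tendsto_nhds_unique (hL (c • x) y)
          (by simpa only [map_smul, inner_smul_left] using (hL x y).const_mul _) }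
    r hvb
  refine ⟨T, LinearMap.mkContinuous_norm_le _ hr _, ?_⟩
  rw [ContinuousLinearMapWOT.le_nhds_iff_forall_inner_apply_le_nhds]
  intro x y
  have h := (hL x y).star
  have e : star (L x y) = ⟪y, (ContinuousLinearMapWOT.ofCLM T) x⟫_ℂ := by
    rw [← hv x y]; exact inner_conj_symm _ _
  rw [e] at h
  refine Tendsto.congr (fun A => ?_) h
  exact inner_conj_symm _ _

/-- The matrix coefficient `A ↦ ⟪η, A ξ⟫` as a continuous functional for the weak operator
topology. -/
noncomputable def wotCoeff (η ξ : H) : (H →WOT[ℂ] H) →L[ℂ] ℂ where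
  toFun A := ⟪η, A ξ⟫_ℂ
  map_add' A B := by simp
  map_smul' c A := by simp
  cont := ContinuousLinearMapWOT.continuous_iff.1 continuous_id ξ η

theorem VonNeumannAlgebra.mem_iff_commute (M : VonNeumannAlgebra H) {x : H →L[ℂ] H} :
    x ∈ M ↔ ∀ a ∈ M.commutant, a * x = x * a := by
  conv_lhs => rw [← M.commutant_commutant]
  exact mem_commutant_iff

theorem VonNeumannAlgebra.isClosed_wot (M : VonNeumannAlgebra H) :
    IsClosed {A : H →WOT[ℂ] H | A.toCLM ∈ M} := by
  have : {A : H →WOT[ℂ] H | A.toCLM ∈ M} =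
      ⋂ a ∈ M.commutant, {A : H →WOT[ℂ] H | .ofCLM a * A = A * .ofCLM a} := by
    ext A
    simp only [Set.mem_ofPred_eq, Set.mem_iInter, M.mem_iff_commute]
    refine forall₂_congr fun a _ => ?_
    rw [← ContinuousLinearMapWOT.toCLM_injective.eq_iff]
    rfl
  rw [this]
  exact isClosed_biInter fun a _ => isClosed_eq (continuous_const_mul _) (continuous_mul_const _)

theorem VonNeumannAlgebra.isCompact_wot_ball (M : VonNeumannAlgebra H) (r : ℝ) :
    IsCompact {A : H →WOT[ℂ] H | A.toCLM ∈ M ∧ ‖A.toCLM‖ ≤ r} := by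
  rw [isCompact_iff_ultrafilter_le_nhds]
  intro F hF
  rw [le_principal_iff] at hF
  obtain ⟨T, hT, hle⟩ := F.exists_le_nhds_wot (r := r) (by filter_upwards [hF] with A hA using hA.2)
  refine ⟨.ofCLM T, ⟨?_, hT⟩, hle⟩
  exact isClosed_iff_ultrafilter.1 M.isClosed_wot (.ofCLM T) F hle
    (by filter_upwards [hF] with A hA using hA.1)

theorem VonNeumannAlgebra.complex_smul_mem (M : VonNeumannAlgebra H) (c : ℂ) {x : H →L[ℂ] H}
    (hx : x ∈ M) : c • x ∈ M :=
  M.toStarSubalgebra.smul_mem hx c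

theorem VonNeumannAlgebra.cfc_mem (M : VonNeumannAlgebra H) {x : H →L[ℂ] H}
    (hx : x ∈ M) (f : ℝ → ℝ) : cfc f x ∈ M := by
  rw [M.mem_iff_commute] at hx ⊢
  intro a ha
  exact ((show Commute x a from (hx a ha).symm).cfc_real f).eq.symm

theorem VonNeumannAlgebra.starProjection_mem (M : VonNeumannAlgebra H) (V : Submodule ℂ H)
    [V.HasOrthogonalProjection] (hV : ∀ a ∈ M.commutant, ∀ v ∈ V, a v ∈ V) :
    V.starProjection ∈ M := by
  rw [IsStarProjection.mem_iff (isStarProjection_starProjection)]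
  intro a ha v hv
  simp at hv ⊢
  exact hV a ha v hv

end WeakCompactness

section Trace

open Filter Topology InnerProductSpace

variable {H : Type*} [NormedAddCommGroup H] [InnerProductSpace ℂ H] [CompleteSpace H]

theorem VonNeumannAlgebra.real_smul_mem (M : VonNeumannAlgebra H) (r : ℝ) {x : H →L[ℂ] H}
    (hx : x ∈ M) : r • x ∈ M := by
  have := M.complex_smul_mem (r : ℂ) hx
  rwa [Complex.coe_smul] at this

theorem ContinuousLinearMap.le_iff_inner {E : Type*} [NormedAddCommGroup E]
    [InnerProductSpace ℂ E] {S T : E →L[ℂ] E} :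
    S ≤ T ↔ ∀ v, 0 ≤ ⟪v, (T - S) v⟫_ℂ := by
  rw [ContinuousLinearMap.le_def, ContinuousLinearMap.isPositive_iff_complex]
  refine forall_congr' fun v => ?_
  rw [← inner_conj_symm v, Complex.le_def, Complex.ext_iff]
  simp only [Complex.conj_re, Complex.conj_im, Complex.zero_re, Complex.zero_im, Complex.ofReal_im]
  constructor
  · rintro ⟨⟨-, h⟩, h'⟩
    exact ⟨h', by simpa using h.symm⟩
  · rintro ⟨h, h'⟩
    exact ⟨⟨rfl, by simpa [eq_comm] using h'⟩, h⟩

theorem ContinuousLinearMap.isClosed_wot_le (S : H →L[ℂ] H) :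
    IsClosed {A : H →WOT[ℂ] H | S ≤ A.toCLM} := by
  simp only [ContinuousLinearMap.le_iff_inner, Set.ofPred_forall]
  refine isClosed_iInter fun v => isClosed_le continuous_const ?_
  simp only [sub_apply, inner_sub_right]
  exact (wotCoeff v v).continuous.sub continuous_const

theorem ContinuousLinearMap.isClosed_wot_ge (S : H →L[ℂ] H) :
    IsClosed {A : H →WOT[ℂ] H | A.toCLM ≤ S} := by
  simp only [ContinuousLinearMap.le_iff_inner, Set.ofPred_forall]
  refine isClosed_iInter fun v => isClosed_le continuous_const ?_
  simp only [sub_apply, inner_sub_right]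
  exact continuous_const.sub (wotCoeff v v).continuous

/-- Every nonnegative element of a von Neumann algebra is the square of a nonnegative element. -/
theorem VonNeumannAlgebra.exists_sqrt (M : VonNeumannAlgebra H) {a : H →L[ℂ] H} (ha : a ∈ M)
    (h0 : 0 ≤ a) : ∃ s ∈ M, star s = s ∧ s * s = a := by
  refine ⟨cfc Real.sqrt a, M.cfc_mem ha _, (cfc_predicate Real.sqrt a : IsSelfAdjoint _).star_eq, ?_⟩
  rw [← cfc_mul Real.sqrt Real.sqrt a, cfc_congr (g := id), cfc_id ℝ a]
  intro t ht
  exact Real.mul_self_sqrt (spectrum_nonneg_of_nonneg h0 ht)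

/-- A faithful positive trace on a von Neumann algebra (not assumed normal). -/
structure IsFaithfulTrace (M : VonNeumannAlgebra H) (τ : (H →L[ℂ] H) →ₗ[ℂ] ℂ) : Prop where
  pos : ∀ x ∈ M, 0 ≤ τ (star x * x)
  faithful : ∀ x ∈ M, τ (star x * x) = 0 → x = 0
  comm : ∀ x ∈ M, ∀ y ∈ M, τ (x * y) = τ (y * x)

namespace IsFaithfulTrace

variable {M K : VonNeumannAlgebra H} {τ : (H →L[ℂ] H) →ₗ[ℂ] ℂ}

theorem nonneg (h : IsFaithfulTrace M τ) {a : H →L[ℂ] H} (ha : a ∈ M) (h0 : 0 ≤ a) :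
    0 ≤ τ a := by
  obtain ⟨s, hs, hss, rfl⟩ := M.exists_sqrt ha h0
  simpa [hss] using h.pos s hs

theorem re_mono (h : IsFaithfulTrace M τ) {a b : H →L[ℂ] H} (ha : a ∈ M) (hb : b ∈ M)
    (hab : a ≤ b) : (τ a).re ≤ (τ b).re := by
  have := (Complex.le_def.1 (h.nonneg (sub_mem hb ha) (sub_nonneg.2 hab))).1
  simpa using this

theorem map_star (h : IsFaithfulTrace M τ) {x : H →L[ℂ] H} (hx : x ∈ M) :
    τ (star x) = star (τ x) := by
  have h1 := (Complex.le_def.1 (h.pos (1 + x) (add_mem (one_mem M) hx))).2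
  have h2 := (Complex.le_def.1
    (h.pos (1 + Complex.I • x) (add_mem (one_mem M) (M.complex_smul_mem _ hx)))).2
  have h3 := (Complex.le_def.1 (h.pos x hx)).2
  have h4 := (Complex.le_def.1 (h.pos 1 (one_mem M))).2
  simp [add_mul, mul_add, smul_smul] at h1 h2 h3 h4
  apply Complex.ext
  · simp; linarith
  · simp; linarith

/-- The Cauchy-Schwarz inequality for a trace. -/
theorem norm_sq_le (h : IsFaithfulTrace M τ) {x y : H →L[ℂ] H} (hx : x ∈ M) (hy : y ∈ M) :
    ‖τ (star x * y)‖ ^ 2 ≤ (τ (star x * x)).re * (τ (star y * y)).re := by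
  let c : PreInnerProductSpace.Core ℂ M.toStarSubalgebra :=
    { inner := fun a b => τ (star (a : H →L[ℂ] H) * b)
      conj_inner_symm := fun a b => by
        have := h.map_star (mul_mem (star_mem b.2) a.2 :
          star (b : H →L[ℂ] H) * (a : H →L[ℂ] H) ∈ M)
        simpa using this.symm
      re_inner_nonneg := fun a => (Complex.le_def.1 (h.pos a a.2)).1
      add_left := fun a b d => by simp [add_mul]
      smul_left := fun a b r => by simp }
  have := @InnerProductSpace.Core.inner_mul_inner_self_le ℂ M.toStarSubalgebra _ _ _ c
    ⟨x, hx⟩ ⟨y, hy⟩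
  change ‖τ (star x * y)‖ * ‖τ (star y * x)‖ ≤ _ at this
  have e : ‖τ (star y * x)‖ = ‖τ (star x * y)‖ := by
    have := h.map_star (mul_mem (star_mem hx) hy : star x * y ∈ M)
    rw [star_mul, star_star] at this
    rw [this, norm_star]
  rw [e, ← sq] at this
  exact this

end IsFaithfulTrace

/-- A linear functional on a space of operators that is bounded by the norm of the evaluation at a
vector `η` is a matrix coefficient at `η`. -/
theorem exists_eq_inner_of_norm_le (V : Submodule ℂ (H →L[ℂ] H)) (L : V →ₗ[ℂ] ℂ) (η : H) (C : ℝ)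
    (hL : ∀ y : V, ‖L y‖ ≤ C * ‖(y : H →L[ℂ] H) η‖) :
    ∃ ζ : H, ∀ y : V, L y = ⟪ζ, (y : H →L[ℂ] H) η⟫_ℂ := by
  let f : V →ₗ[ℂ] H :=
    { toFun := fun y => (y : H →L[ℂ] H) η
      map_add' := fun _ _ => rfl
      map_smul' := fun _ _ => rfl }
  have hker : LinearMap.ker f ≤ LinearMap.ker L := by
    intro y hy
    have hy' : (y : H →L[ℂ] H) η = 0 := hy
    have := hL y
    rw [hy', norm_zero, mul_zero] at this
    exact norm_le_zero_iff.1 this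
  let g₀ : LinearMap.range f →ₗ[ℂ] ℂ :=
    ((LinearMap.ker f).liftQ L hker).comp f.quotKerEquivRange.symm.toLinearMap
  have hg₀ : ∀ y : V, g₀ ⟨f y, LinearMap.mem_range_self f y⟩ = L y := by
    intro y
    have : f.quotKerEquivRange.symm ⟨f y, LinearMap.mem_range_self f y⟩ =
        (LinearMap.ker f).mkQ y := f.quotKerEquivRange_symm_apply_image y _
    simp only [g₀, LinearMap.comp_apply, LinearEquiv.coe_coe, this]
    simp
  let g₁ : LinearMap.range f →L[ℂ] ℂ := g₀.mkContinuous C (by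
    rintro ⟨_, y, rfl⟩
    rw [hg₀]
    exact hL y)
  obtain ⟨g, hg, -⟩ := exists_extension_norm_eq _ g₁
  refine ⟨(InnerProductSpace.toDual ℂ H).symm g, fun y => ?_⟩
  rw [InnerProductSpace.toDual_symm_apply, ← hg₀ y]
  exact (hg ⟨f y, LinearMap.mem_range_self f y⟩).symm

end Trace

section NormalIdeal

open Filter Topology InnerProductSpace

variable {H : Type*} [NormedAddCommGroup H] [InnerProductSpace ℂ H] [CompleteSpace H]

/-- The elements `b` of `K` for which all the functionals `y ↦ τ (x * y * (a * b))` on `K` are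
continuous for the weak operator topology. -/
def IsNormalAt (M K : VonNeumannAlgebra H) (τ : (H →L[ℂ] H) →ₗ[ℂ] ℂ) (b : H →L[ℂ] H) : Prop :=
  b ∈ K ∧ ∀ x ∈ M, ∀ a ∈ K, ∃ g : (H →WOT[ℂ] H) →L[ℂ] ℂ,
    ∀ y ∈ K, τ (x * y * (a * b)) = g (.ofCLM y)

variable {M K : VonNeumannAlgebra H} {τ : (H →L[ℂ] H) →ₗ[ℂ] ℂ} {b c : H →L[ℂ] H}

namespace IsNormalAt

theorem add (hb : IsNormalAt M K τ b) (hc : IsNormalAt M K τ c) : IsNormalAt M K τ (b + c) := by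
  refine ⟨add_mem hb.1 hc.1, fun x hx a ha => ?_⟩
  obtain ⟨g, hg⟩ := hb.2 x hx a ha
  obtain ⟨g', hg'⟩ := hc.2 x hx a ha
  refine ⟨g + g', fun y hy => ?_⟩
  simp only [mul_add, map_add, hg y hy, hg' y hy]
  rfl

theorem mul_left (hb : IsNormalAt M K τ b) (hc : c ∈ K) : IsNormalAt M K τ (c * b) := by
  refine ⟨mul_mem hc hb.1, fun x hx a ha => ?_⟩
  obtain ⟨g, hg⟩ := hb.2 x hx (a * c) (mul_mem ha hc)
  exact ⟨g, fun y hy => by rw [← mul_assoc a, hg y hy]⟩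

theorem mul_right (h : IsFaithfulTrace M τ) (hKM : ∀ x ∈ K, x ∈ M) (hb : IsNormalAt M K τ b)
    (hc : c ∈ K) : IsNormalAt M K τ (b * c) := by
  refine ⟨mul_mem hb.1 hc, fun x hx a ha => ?_⟩
  obtain ⟨g, hg⟩ := hb.2 (c * x) (mul_mem (hKM c hc) hx) a ha
  refine ⟨g, fun y hy => ?_⟩
  rw [← hg y hy, mul_assoc c, mul_assoc c, ← h.comm _ _ c (hKM c hc)]
  · simp only [mul_assoc]
  · exact mul_mem (mul_mem hx (hKM y hy)) (hKM _ (mul_mem ha hb.1))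

end IsNormalAt

/-- The Zorn step of a Hahn decomposition: near any nonzero vector `ξ`, a trace is dominated by a
multiple of the vector functional of `ξ` below some positive element. -/
theorem IsFaithfulTrace.exists_dominated (h : IsFaithfulTrace K τ) {ξ : H} (hξ : ξ ≠ 0) :
    ∃ m ∈ K, 0 ≤ m ∧ m ξ ≠ 0 ∧ ∃ C : ℝ, 0 ≤ C ∧
      ∀ y ∈ K, 0 ≤ y → y ≤ m → (τ y).re ≤ C * (⟪ξ, y ξ⟫_ℂ).re := by
  have hξ' : 0 < ‖ξ‖ ^ 2 := by positivity
  have hτ1 : 0 ≤ (τ 1).re := by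
    simpa using (Complex.le_def.1 (h.pos 1 (one_mem K))).1
  set C : ℝ := ((τ 1).re + 1) / ‖ξ‖ ^ 2 with hC
  have hCpos : 0 < C := by positivity
  have hωmono : ∀ {a b : H →L[ℂ] H}, a ≤ b → (⟪ξ, a ξ⟫_ℂ).re ≤ (⟪ξ, b ξ⟫_ℂ).re := by
    intro a b hab
    have := (Complex.le_def.1 (ContinuousLinearMap.le_iff_inner.1 hab ξ)).1
    simpa [inner_sub_right] using this
  let S : Set (H →L[ℂ] H) := {b | b ∈ K ∧ 0 ≤ b ∧ b ≤ 1 ∧ C * (⟪ξ, b ξ⟫_ℂ).re ≤ (τ b).re}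
  obtain ⟨b, -, hb⟩ := zorn_le_nonempty₀ S (by
    intro c hcS hc y hy
    have : Nonempty c := ⟨⟨y, hy⟩⟩
    let s : ℝ := ⨆ b : c, (⟪ξ, (b : H →L[ℂ] H) ξ⟫_ℂ).re
    have hbdd : BddAbove (Set.range fun b : c => (⟪ξ, (b : H →L[ℂ] H) ξ⟫_ℂ).re) := by
      refine ⟨(⟪ξ, (1 : H →L[ℂ] H) ξ⟫_ℂ).re, ?_⟩
      rintro _ ⟨b, rfl⟩
      exact hωmono (hcS b.2).2.2.1
    let t : c → Set (H →WOT[ℂ] H) := fun b =>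
      {A | A.toCLM ∈ K ∧ ‖A.toCLM‖ ≤ 1} ∩
        ({A | (b : H →L[ℂ] H) ≤ A.toCLM} ∩ ({A | A.toCLM ≤ 1} ∩
          {A | (wotCoeff ξ ξ A).re ≤ s}))
    have hcl : ∀ b : c, IsClosed ({A : H →WOT[ℂ] H | (b : H →L[ℂ] H) ≤ A.toCLM} ∩
        ({A | A.toCLM ≤ 1} ∩ {A | (wotCoeff ξ ξ A).re ≤ s})) := fun b =>
      (ContinuousLinearMap.isClosed_wot_le _).inter
        ((ContinuousLinearMap.isClosed_wot_ge _).inter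
          (isClosed_le (Complex.continuous_re.comp (wotCoeff ξ ξ).continuous) continuous_const))
    have hcomp : ∀ b, IsCompact (t b) := fun b => (K.isCompact_wot_ball 1).inter_right (hcl b)
    obtain ⟨A, hA⟩ := IsCompact.nonempty_iInter_of_directed_nonempty_isCompact_isClosed t
      (by
        intro b b'
        rcases hc.total b.2 b'.2 with hbb | hbb
        · exact ⟨b', fun A hA => ⟨hA.1, hbb.trans hA.2.1, hA.2.2⟩, fun A hA => hA⟩
        · exact ⟨b, fun A hA => hA, fun A hA => ⟨hA.1, hbb.trans hA.2.1, hA.2.2⟩⟩)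
      (by
        intro b
        have hbS := hcS b.2
        exact ⟨.ofCLM b, ⟨hbS.1, (CStarAlgebra.norm_le_one_iff_of_nonneg _ hbS.2.1).2 hbS.2.2.1⟩,
          le_refl (b : H →L[ℂ] H), hbS.2.2.1, le_ciSup hbdd b⟩)
      hcomp (fun b => (hcomp b).isClosed)
    rw [Set.mem_iInter] at hA
    refine ⟨A.toCLM, ⟨(hA ⟨y, hy⟩).1.1, (hcS hy).2.1.trans (hA ⟨y, hy⟩).2.1,
      (hA ⟨y, hy⟩).2.2.1, ?_⟩, fun z hz => (hA ⟨z, hz⟩).2.1⟩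
    have hs : s ≤ (τ A.toCLM).re / C := by
      refine ciSup_le fun b => ?_
      rw [le_div_iff₀' hCpos]
      exact (hcS b.2).2.2.2.trans (h.re_mono (hcS b.2).1 (hA b).1.1 (hA b).2.1)
    rw [← le_div_iff₀' hCpos]
    exact (hA ⟨y, hy⟩).2.2.2.trans hs) 0 ⟨zero_mem K, le_rfl, zero_le_one, by simp⟩
  obtain ⟨⟨hbK, hb0, hb1, hbC⟩, hmax⟩ := hb
  refine ⟨1 - b, sub_mem (one_mem K) hbK, sub_nonneg.2 hb1, ?_, C, hCpos.le, ?_⟩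
  · intro hm
    have hbξ : b ξ = ξ := by
      have : ξ - b ξ = 0 := by simpa using hm
      exact (sub_eq_zero.1 this).symm
    rw [hbξ, inner_self_eq_norm_sq_to_K] at hbC
    have e : ((‖ξ‖ : ℂ) ^ 2).re = ‖ξ‖ ^ 2 := by
      rw [← Complex.ofReal_pow, Complex.ofReal_re]
    have hbC' : C * ‖ξ‖ ^ 2 ≤ (τ b).re := by
      rw [← e]; exact hbC
    have := h.re_mono hbK (one_mem K) hb1
    rw [hC, div_mul_cancel₀ _ hξ'.ne'] at hbC'
    linarith
  · intro y hy hy0 hym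
    by_contra! hlt
    have hle := hmax (y := b + y) ⟨add_mem hbK hy, add_nonneg hb0 hy0,
      by simpa using add_le_add_right hym b, by
        simp only [add_apply, inner_add_right, map_add, Complex.add_re, mul_add]
        linarith⟩ (le_add_of_nonneg_right hy0)
    have hy' : y = 0 := le_antisymm (by simpa using hle) hy0
    simp [hy'] at hlt

/-- Near any nonzero vector there is a positive element at which the trace is normal. -/
theorem IsFaithfulTrace.exists_isNormalAt (h : IsFaithfulTrace M τ) (hKM : ∀ x ∈ K, x ∈ M)
    {ξ : H} (hξ : ξ ≠ 0) : ∃ m, IsNormalAt M K τ m ∧ 0 ≤ m ∧ m ξ ≠ 0 := by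
  have hK : IsFaithfulTrace K τ := ⟨fun x hx => h.pos x (hKM x hx),
    fun x hx => h.faithful x (hKM x hx), fun x hx y hy => h.comm x (hKM x hx) y (hKM y hy)⟩
  obtain ⟨m, hm, hm0, hmξ, C, hC, hdom⟩ := hK.exists_dominated hξ
  obtain ⟨s, hs, hss, hsm⟩ := K.exists_sqrt hm hm0
  have key : ∀ y ∈ K, (τ (star (y * s) * (y * s))).re ≤ C * ‖y (s ξ)‖ ^ 2 := by
    intro y hy
    set z := star (y * s) * (y * s) with hz
    have hzK : z ∈ K := mul_mem (star_mem (mul_mem hy hs)) (mul_mem hy hs)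
    have hz0 : 0 ≤ z := star_mul_self_nonneg _
    have hzω : (⟪ξ, z ξ⟫_ℂ).re = ‖y (s ξ)‖ ^ 2 := by
      have : ⟪ξ, z ξ⟫_ℂ = ⟪y (s ξ), y (s ξ)⟫_ℂ :=
        ContinuousLinearMap.adjoint_inner_right (y * s) ξ ((y * s) ξ)
      rw [this, inner_self_eq_norm_sq_to_K]
      exact (congrArg Complex.re (Complex.ofReal_pow _ _).symm).trans (Complex.ofReal_re _)
    set t : ℝ := ‖star y * y‖ + 1 with ht
    have ht0 : 0 < t := by positivity
    have hzle : z ≤ t • m := by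
      have h1 := CStarAlgebra.star_left_conjugate_le_norm_smul (a := s) (b := star y * y)
        (IsSelfAdjoint.star_mul_self y)
      rw [hss, hsm] at h1
      have h2 : z = s * (star y * y) * s := by rw [hz, star_mul, hss]; simp only [mul_assoc]
      rw [h2]
      exact h1.trans (smul_le_smul_of_nonneg_right (by linarith) hm0)
    have h3 := hdom (t⁻¹ • z) (K.real_smul_mem _ hzK) (smul_nonneg (by positivity) hz0)
      (by
        have := smul_le_smul_of_nonneg_left hzle (inv_nonneg.2 ht0.le)
        rwa [smul_smul, inv_mul_cancel₀ ht0.ne', one_smul] at this)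
    rw [← Complex.coe_smul, map_smul, smul_apply, inner_smul_right, smul_eq_mul,
      Complex.re_ofReal_mul, Complex.re_ofReal_mul, hzω, mul_left_comm] at h3
    exact le_of_mul_le_mul_left h3 (by positivity)
  refine ⟨m, ⟨hm, fun x hx a ha => ?_⟩, hm0, hmξ⟩
  have hsM := hKM s hs
  set D : ℝ := (τ (star (star x * s) * (star x * s))).re with hD
  have hD0 : 0 ≤ D := (Complex.le_def.1 (h.pos _ (mul_mem (star_mem hx) hsM))).1
  let L : K.toStarSubalgebra.toSubalgebra.toSubmodule →ₗ[ℂ] ℂ :=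
    { toFun := fun y => τ (x * y * (a * m))
      map_add' := fun y z => by simp [mul_add, add_mul]
      map_smul' := fun c y => by simp }
  obtain ⟨ζ, hζ⟩ := exists_eq_inner_of_norm_le _ L (a (s ξ)) (Real.sqrt (D * C)) (by
    rintro ⟨y, hy⟩
    change ‖τ (x * y * (a * m))‖ ≤ _ * ‖y (a (s ξ))‖
    have hya : y * a ∈ K := mul_mem hy ha
    have e : τ (x * y * (a * m)) = τ (star (star x * s) * (y * a * s)) := by
      rw [star_mul, star_star, hss, mul_assoc s, h.comm s hsM]
      · rw [← hsm]; simp only [mul_assoc]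
      · exact mul_mem hx (hKM _ (mul_mem hya hs))
    have h1 := h.norm_sq_le (mul_mem (star_mem hx) hsM) (hKM _ (mul_mem hya hs))
    rw [← e] at h1
    have h2 := h1.trans (mul_le_mul_of_nonneg_left (key _ hya) hD0)
    refine le_of_sq_le_sq ?_ (by positivity)
    rw [mul_pow, Real.sq_sqrt (by positivity)]
    calc _ ≤ _ := h2
      _ = _ := by rw [mul_assoc]; rfl)
  exact ⟨wotCoeff ζ (a (s ξ)), fun y hy => hζ ⟨y, hy⟩⟩

end NormalIdeal

section Projections

open Filter Topology InnerProductSpace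

variable {H : Type*} [NormedAddCommGroup H] [InnerProductSpace ℂ H] [CompleteSpace H]
  {M K : VonNeumannAlgebra H} {τ : (H →L[ℂ] H) →ₗ[ℂ] ℂ}

theorem IsNormalAt.exists_isStarProjection {m : H →L[ℂ] H} (hm : IsNormalAt M K τ m)
    (h0 : 0 ≤ m) (hne : m ≠ 0) :
    ∃ q c, IsStarProjection q ∧ q ≠ 0 ∧ IsNormalAt M K τ q ∧ q = m * c := by
  have : Nontrivial (H →L[ℂ] H) := ⟨m, 0, hne⟩
  set δ : ℝ := ‖m‖ / 2 with hδ
  have hδ0 : 0 < δ := by have := norm_pos_iff.2 hne; positivity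
  let g : ℝ → ℝ := fun t => (max t δ)⁻¹
  have hmax : ∀ t, max t δ ≠ 0 := fun t => (lt_max_of_lt_right hδ0).ne'
  have hg : Continuous g := (continuous_id.max continuous_const).inv₀ hmax
  let p : ℝ → ℝ := fun t => max (t - δ) 0
  have hp : Continuous p := by fun_prop
  have hmsa : IsSelfAdjoint m := IsSelfAdjoint.of_nonneg h0
  have hgp : m * cfc g m * cfc p m = cfc p m := by
    have h1 : m * cfc g m = cfc (fun t => t * g t) m := by
      rw [cfc_mul (fun t => t) g m continuousOn_id hg.continuousOn, cfc_id' ℝ m]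
    rw [h1, ← cfc_mul (fun t => t * g t) p m (continuous_id.mul hg).continuousOn hp.continuousOn]
    refine cfc_congr fun t _ => ?_
    rcases le_total t δ with h | h
    · simp [p, h]
    · have : t ≠ 0 := (hδ0.trans_le h).ne'
      simp [p, g, h, this]
  have hcomm : Commute (cfc g m) m := (Commute.refl m).symm.cfc_real g
  let V : Submodule ℂ H := LinearMap.ker (m * cfc g m - 1 : H →L[ℂ] H).toLinearMap
  have hVmem : ∀ v, v ∈ V ↔ m (cfc g m v) = v := fun v => by
    simp [V, LinearMap.mem_ker, sub_eq_zero]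
  have hVc : IsClosed (V : Set H) := (m * cfc g m - 1 : H →L[ℂ] H).isClosed_ker
  have : CompleteSpace V := hVc.completeSpace_coe
  have hgK : cfc g m ∈ K := K.cfc_mem hm.1 g
  have hqK : V.starProjection ∈ K := K.starProjection_mem V (by
    intro a ha v hv
    rw [hVmem] at hv ⊢
    have h1 := (K.mem_iff_commute.1 (mul_mem hm.1 hgK)) a ha
    have := congrArg (fun T : H →L[ℂ] H => T v) h1
    simp only [mul_apply_eq_comp, hv] at this
    exact this.symm)
  have hmq : V.starProjection = m * (cfc g m * V.starProjection) := by
    ext v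
    exact ((hVmem _).1 (V.starProjection_apply_mem v)).symm
  refine ⟨V.starProjection, cfc g m * V.starProjection, isStarProjection_starProjection, ?_, ?_, hmq⟩
  · intro hq
    have h1 : V.starProjection * cfc p m = cfc p m := by
      ext v
      refine V.starProjection_eq_self_iff.2 ((hVmem _).2 ?_)
      exact congrArg (fun T : H →L[ℂ] H => T v) hgp
    rw [hq, zero_mul] at h1
    have h2 := norm_apply_le_norm_cfc p m (hf := hp.continuousOn)
      (CStarAlgebra.norm_mem_spectrum_of_nonneg (a := m) h0)
    rw [← h1, norm_zero] at h2
    have h3 : p ‖m‖ = δ := by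
      have : ‖m‖ - δ = δ := by rw [hδ]; ring
      simp [p, this, hδ0.le]
    rw [h3, Real.norm_eq_abs, abs_of_pos hδ0] at h2
    linarith
  · have hs : V.starProjection = V.starProjection * cfc g m * m := by
      have h1 := congrArg star hmq
      have h2 : star V.starProjection = V.starProjection :=
        isStarProjection_starProjection.isSelfAdjoint.star_eq
      have h3 : star (cfc g m) = cfc g m := (cfc_predicate g m : IsSelfAdjoint _).star_eq
      rwa [star_mul, star_mul, h2, h3, hmsa.star_eq] at h1
    rw [hs]
    exact hm.mul_left (mul_mem hqK hgK)

end Projections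

section Comparison

open Filter Topology InnerProductSpace

variable {H : Type*} [NormedAddCommGroup H] [InnerProductSpace ℂ H] [CompleteSpace H]
  {M K : VonNeumannAlgebra H} {τ : (H →L[ℂ] H) →ₗ[ℂ] ℂ}

theorem IsStarProjection.norm_sub_mul_star_apply_sq_le {r w : H →L[ℂ] H} (hr : IsStarProjection r)
    (hrw : r * w = w) (hw : ‖w‖ ≤ 1) (η : H) :
    ‖(r - w * star w) η‖ ^ 2 ≤ ‖η‖ ^ 2 - ‖star w η‖ ^ 2 := by
  have h1 : star w (r η) = star w η := by
    have := congrArg star hrw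
    rw [star_mul, hr.isSelfAdjoint.star_eq] at this
    exact congrArg (fun T : H →L[ℂ] H => T η) this
  have h2 : ⟪r η, w (star w η)⟫_ℂ = ⟪star w η, star w η⟫_ℂ := by
    rw [← h1]
    exact (ContinuousLinearMap.adjoint_inner_left w _ _).symm
  have h3 : ‖w (star w η)‖ ≤ ‖star w η‖ := by
    simpa using w.le_of_opNorm_le hw (star w η)
  have h4 : ‖r η‖ ≤ ‖η‖ := by
    simpa using r.le_of_opNorm_le hr.norm_le η
  have h5 : (r - w * star w) η = r η - w (star w η) := rfl
  rw [h5, norm_sub_sq (𝕜 := ℂ), h2, inner_self_eq_norm_sq]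
  have h6 := pow_le_pow_left₀ (norm_nonneg _) h3 2
  have h7 := pow_le_pow_left₀ (norm_nonneg _) h4 2
  linarith

theorem IsStarProjection.norm_add_half_smul_le_one {r q w a : H →L[ℂ] H} (hr : IsStarProjection r)
    (hq : IsStarProjection q) (hrw : r * w = w) (hwq : w * q = w) (hw : ‖w‖ ≤ 1) (ha : ‖a‖ ≤ 1) :
    ‖w + (2⁻¹ : ℂ) • ((r - w * star w) * a * (q - star w * w))‖ ≤ 1 := by
  refine ContinuousLinearMap.opNorm_le_bound _ zero_le_one fun ξ => ?_
  rw [one_mul]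
  rcases eq_or_ne ξ 0 with rfl | hξ
  · simp
  set P := r - w * star w with hP
  set Q := q - star w * w with hQ
  set η := (w + (2⁻¹ : ℂ) • (P * a * Q)) ξ with hη
  have hη' : η = w ξ + (2⁻¹ : ℂ) • P (a (Q ξ)) := rfl
  have e1 : ‖P η‖ ^ 2 ≤ ‖η‖ ^ 2 - ‖star w η‖ ^ 2 := hr.norm_sub_mul_star_apply_sq_le hrw hw η
  have e2 : ‖Q ξ‖ ^ 2 ≤ ‖ξ‖ ^ 2 - ‖w ξ‖ ^ 2 := by
    have hqw : q * star w = star w := by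
      have := congrArg star hwq
      rwa [star_mul, hq.isSelfAdjoint.star_eq] at this
    have := hq.norm_sub_mul_star_apply_sq_le hqw (by rwa [norm_star]) ξ
    rwa [star_star, ← hQ] at this
  have hPsa : star P = P := by simp [hP, hr.isSelfAdjoint.star_eq]
  have e3 : ⟪η, P (a (Q ξ))⟫_ℂ = ⟪P η, a (Q ξ)⟫_ℂ := by
    conv_rhs => rw [← hPsa]
    exact (ContinuousLinearMap.adjoint_inner_left P _ _).symm
  have e4 : ‖⟪P η, a (Q ξ)⟫_ℂ‖ ≤ ‖P η‖ * ‖Q ξ‖ := by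
    refine (norm_inner_le_norm _ _).trans ?_
    gcongr
    simpa using a.le_of_opNorm_le ha (Q ξ)
  have e5 : ‖η‖ ^ 2 ≤ ‖⟪η, w ξ⟫_ℂ‖ + 2⁻¹ * (‖P η‖ * ‖Q ξ‖) := by
    have h1 : ‖⟪η, η⟫_ℂ‖ = ‖η‖ ^ 2 := by
      rw [inner_self_eq_norm_sq_to_K]; simp
    rw [← h1]
    conv_lhs => enter [1]; rw [hη', inner_add_right, inner_smul_right, ← hη', e3]
    refine (norm_add_le _ _).trans ?_
    rw [norm_mul]
    gcongr
    simp
  have e6 : ‖⟪η, w ξ⟫_ℂ‖ ≤ ‖η‖ * ‖w ξ‖ := norm_inner_le_norm _ _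
  have e7 : ‖⟪η, w ξ⟫_ℂ‖ ≤ ‖star w η‖ * ‖ξ‖ := by
    rw [← ContinuousLinearMap.adjoint_inner_left w]
    exact norm_inner_le_norm _ _
  set s := ‖⟪η, w ξ⟫_ℂ‖
  have hs : 0 ≤ s := norm_nonneg _
  have hk : 0 < ‖ξ‖ := norm_pos_iff.2 hξ
  have f1 : s ^ 2 ≤ ‖η‖ ^ 2 * ‖w ξ‖ ^ 2 := by
    rw [← mul_pow]; exact pow_le_pow_left₀ hs e6 2
  have f2 : s ^ 2 ≤ ‖star w η‖ ^ 2 * ‖ξ‖ ^ 2 := by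
    rw [← mul_pow]; exact pow_le_pow_left₀ hs e7 2
  have f3 := mul_le_mul_of_nonneg_right e1 (sq_nonneg ‖ξ‖)
  have f4 := mul_le_mul_of_nonneg_left e2 (sq_nonneg ‖η‖)
  have f5 := two_mul_le_add_sq (‖P η‖ * ‖ξ‖) (‖η‖ * ‖Q ξ‖)
  have f6 := mul_le_mul_of_nonneg_right e5 (mul_nonneg (norm_nonneg η) hk.le)
  by_contra! hlt
  have hη0 : 0 < ‖η‖ := hk.trans hlt
  have f7 : ‖η‖ ^ 2 * ‖ξ‖ * ‖η‖ ≤ ‖η‖ ^ 2 * ‖ξ‖ * ‖ξ‖ := by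
    linarith [sq_nonneg (‖η‖ * ‖ξ‖ - s)]
  exact hlt.not_ge (le_of_mul_le_mul_left f7 (by positivity))

/-- A maximality argument for partial isometries, replaced by a choice of an extreme point. -/
theorem VonNeumannAlgebra.exists_comparison (K : VonNeumannAlgebra H) {r q : H →L[ℂ] H}
    (hr : IsStarProjection r) (hq : IsStarProjection q) (hrK : r ∈ K) (hqK : q ∈ K) :
    ∃ w ∈ K, r * w = w ∧ w * q = w ∧
      ∀ a ∈ K, (r - w * star w) * a * (q - star w * w) = 0 := by
  let S : Set (H →WOT[ℂ] H) := {A | A.toCLM ∈ K ∧ ‖A.toCLM‖ ≤ 1} ∩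
    ({A | .ofCLM r * A = A} ∩ {A | A * .ofCLM q = A})
  have hS : IsCompact S := (K.isCompact_wot_ball 1).inter_right
    ((isClosed_eq (continuous_const_mul _) continuous_id).inter
      (isClosed_eq (continuous_mul_const _) continuous_id))
  obtain ⟨A, hA, hext⟩ := hS.extremePoints_nonempty (E := H →WOT[ℂ] H) ⟨0, by simp [S, zero_mem]⟩
  obtain ⟨⟨hwK, hw1⟩, hrw, hwq⟩ := hA
  set w := A.toCLM
  replace hrw : r * w = w := congrArg ContinuousLinearMapWOT.toCLM hrw
  replace hwq : w * q = w := congrArg ContinuousLinearMapWOT.toCLM hwq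
  have hrP : r * (r - w * star w) = r - w * star w := by
    rw [mul_sub, hr.isIdempotentElem.eq, ← mul_assoc, hrw]
  have hQq : (q - star w * w) * q = q - star w * w := by
    rw [sub_mul, hq.isIdempotentElem.eq, mul_assoc, hwq]
  have key : ∀ a ∈ K, ‖a‖ ≤ 1 → (r - w * star w) * a * (q - star w * w) = 0 := by
    intro a ha ha1
    have hmem : ∀ b ∈ K, ‖b‖ ≤ 1 →
        .ofCLM (w + (2⁻¹ : ℂ) • ((r - w * star w) * b * (q - star w * w))) ∈ S := by
      intro b hb hb1
      refine ⟨⟨add_mem hwK (K.complex_smul_mem _ (mul_mem (mul_mem (sub_mem hrK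
        (mul_mem hwK (star_mem hwK))) hb) (sub_mem hqK (mul_mem (star_mem hwK) hwK)))),
        hr.norm_add_half_smul_le_one hq hrw hwq hw1 hb1⟩, ?_, ?_⟩
      · have : r * (w + (2⁻¹ : ℂ) • ((r - w * star w) * b * (q - star w * w))) =
            w + (2⁻¹ : ℂ) • ((r - w * star w) * b * (q - star w * w)) := by
          rw [mul_add, hrw, mul_smul_comm, ← mul_assoc r, ← mul_assoc r, hrP]
        exact congrArg ContinuousLinearMapWOT.ofCLM this
      · have : (w + (2⁻¹ : ℂ) • ((r - w * star w) * b * (q - star w * w))) * q =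
            w + (2⁻¹ : ℂ) • ((r - w * star w) * b * (q - star w * w)) := by
          rw [add_mul, hwq, smul_mul_assoc, mul_assoc _ _ q, hQq]
        exact congrArg ContinuousLinearMapWOT.ofCLM this
    have h1 := hext (hmem a ha ha1) (hmem (-a) (neg_mem ha) (by rwa [norm_neg]))
      ⟨2⁻¹, 2⁻¹, by norm_num, by norm_num, by norm_num, by
        apply ContinuousLinearMapWOT.toCLM_injective
        change (2⁻¹ : ℝ) • (w + (2⁻¹ : ℂ) • ((r - w * star w) * a * (q - star w * w))) +
          (2⁻¹ : ℝ) • (w + (2⁻¹ : ℂ) • ((r - w * star w) * -a * (q - star w * w))) = w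
        rw [mul_neg, neg_mul]
        module⟩
    have h2 : w + (2⁻¹ : ℂ) • ((r - w * star w) * a * (q - star w * w)) = w :=
      congrArg ContinuousLinearMapWOT.toCLM h1
    simpa using h2
  refine ⟨w, hwK, hrw, hwq, fun a ha => ?_⟩
  rcases eq_or_ne a 0 with rfl | hne
  · simp
  have h1 := key ((‖a‖⁻¹ : ℂ) • a) (K.complex_smul_mem _ ha) (by
    rw [norm_smul, norm_inv, Complex.norm_real, norm_norm,
      inv_mul_cancel₀ (norm_ne_zero_iff.2 hne)])
  rw [mul_smul_comm, smul_mul_assoc, smul_eq_zero] at h1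
  exact h1.resolve_left (by simpa using hne)

end Comparison

section Central

open Filter Topology InnerProductSpace

variable {H : Type*} [NormedAddCommGroup H] [InnerProductSpace ℂ H] [CompleteSpace H]
  {M K : VonNeumannAlgebra H} {τ : (H →L[ℂ] H) →ₗ[ℂ] ℂ}

theorem IsFaithfulTrace.re_pos_of_isStarProjection (h : IsFaithfulTrace M τ) {q : H →L[ℂ] H}
    (hqM : q ∈ M) (hq : IsStarProjection q) (hne : q ≠ 0) : 0 < (τ q).re := by
  have e : star q * q = q := by rw [hq.isSelfAdjoint.star_eq, hq.isIdempotentElem.eq]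
  have h1 := Complex.le_def.1 (h.pos q hqM)
  have h2 := h.faithful q hqM
  rw [e] at h1 h2
  refine lt_of_le_of_ne h1.1 fun h0 => hne (h2 (Complex.ext h0.symm h1.2.symm))

/-- A nonzero projection at which the trace is normal is not orthogonal to all the central
projections with this property. -/
theorem IsNormalAt.exists_central (h : IsFaithfulTrace M τ) (hKM : ∀ x ∈ K, x ∈ M) {q : H →L[ℂ] H}
    (hqn : IsNormalAt M K τ q) (hq : IsStarProjection q) (hne : q ≠ 0) :
    ∃ z, IsNormalAt M K τ z ∧ IsStarProjection z ∧ z ∈ K.commutant ∧ z * q ≠ 0 := by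
  have hqK := hqn.1
  let R : Set ℝ := {t | ∃ r, IsStarProjection r ∧ r ∈ K ∧ IsNormalAt M K τ (1 - r) ∧ (τ r).re = t}
  have hR : BddBelow R := by
    refine ⟨0, ?_⟩
    rintro _ ⟨r, hr, hrK, -, rfl⟩
    exact (Complex.le_def.1 (h.nonneg (hKM r hrK) hr.nonneg)).1
  have hR1 : R.Nonempty := ⟨_, 1, .one _, one_mem K,
    by simpa using hqn.mul_left (zero_mem K), rfl⟩
  obtain ⟨_, ⟨r, hr, hrK, hrn, rfl⟩, hlt⟩ := exists_lt_of_csInf_lt hR1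
    (lt_add_of_pos_right (sInf R) (h.re_pos_of_isStarProjection (hKM q hqK) hq hne))
  obtain ⟨w, hwK, hrw, hwq, hzero⟩ := K.exists_comparison hr hq hrK hqK
  have hwr : star w * r = star w := by
    have := congrArg star hrw
    rwa [star_mul, hr.isSelfAdjoint.star_eq] at this
  have hwn : IsNormalAt M K τ w := by rw [← hwq]; exact hqn.mul_left hwK
  have hwwn : IsNormalAt M K τ (w * star w) := hwn.mul_right h hKM (star_mem hwK)
  set r' := r - w * star w with hr'
  set q' := q - star w * w with hq'
  have hq'K : q' ∈ K := sub_mem hqK (mul_mem (star_mem hwK) hwK)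
  have hq'0 : q' ≠ 0 := by
    intro h0
    have hww : star w * w = q := (sub_eq_zero.1 h0).symm
    have h1 : (τ r').re ∈ R := by
      refine ⟨r', ⟨?_, ?_⟩, sub_mem hrK hwwn.1, ?_, rfl⟩
      · have : w * star w * (w * star w) = w * star w := by
          rw [mul_assoc, ← mul_assoc (star w), hww, ← mul_assoc, hwq]
        rw [IsIdempotentElem, hr', sub_mul, mul_sub, mul_sub, hr.isIdempotentElem.eq, this,
          ← mul_assoc, hrw, mul_assoc w, hwr, sub_self, sub_zero]
      · rw [isSelfAdjoint_iff, hr', star_sub, star_mul, star_star, hr.isSelfAdjoint.star_eq]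
      · have : 1 - r' = (1 - r) + w * star w := by rw [hr']; abel
        rw [this]
        exact hrn.add hwwn
    have h2 := csInf_le hR h1
    rw [hr', map_sub, h.comm w (hKM w hwK) _ (star_mem (hKM w hwK)), hww, Complex.sub_re] at h2
    linarith
  let V : Submodule ℂ H :=
    ⨅ a : K.toStarSubalgebra, LinearMap.ker (r' * (a : H →L[ℂ] H)).toLinearMap
  have hVmem : ∀ v, v ∈ V ↔ ∀ a ∈ K, r' (a v) = 0 := fun v => by
    simp [V, LinearMap.mem_ker, Submodule.mem_iInf]
  have hVc : IsClosed (V : Set H) := by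
    simp only [V, Submodule.coe_iInf]
    exact isClosed_iInter fun a => (r' * (a : H →L[ℂ] H)).isClosed_ker
  have : CompleteSpace V := hVc.completeSpace_coe
  have hr'K : r' ∈ K := sub_mem hrK hwwn.1
  set z := V.starProjection
  have hzK : z ∈ K := K.starProjection_mem V (by
    intro b hb v hv
    rw [hVmem] at hv ⊢
    intro a ha
    have h1 := K.mem_iff_commute.1 (mul_mem hr'K ha) b hb
    have h2 : b (r' (a v)) = r' (a (b v)) := congrArg (fun T : H →L[ℂ] H => T v) h1
    rw [← h2, hv a ha, map_zero])
  have hzK' : z ∈ K.commutant := K.commutant.starProjection_mem V (by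
    intro b hb v hv
    rw [VonNeumannAlgebra.commutant_commutant] at hb
    rw [hVmem] at hv ⊢
    exact fun a ha => hv (a * b) (mul_mem ha hb))
  have hzp : IsStarProjection z := isStarProjection_starProjection
  have hzc : ∀ a ∈ K, a * z = z * a := VonNeumannAlgebra.mem_commutant_iff.1 hzK'
  have hzq' : z * q' = q' := by
    ext v
    refine V.starProjection_eq_self_iff.2 ((hVmem _).2 fun a ha => ?_)
    exact congrArg (fun T : H →L[ℂ] H => T v) (hzero a ha)
  have hzr' : z * r' = 0 := by
    rw [← hzc r' hr'K]
    ext v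
    exact (hVmem _).1 (V.starProjection_apply_mem v) 1 (one_mem K)
  refine ⟨z, ?_, hzp, hzK', ?_⟩
  · have e : z = z * ((1 - r) + w * star w) := by
      have : (1 - r) + w * star w = 1 - r' := by rw [hr']; abel
      rw [this, mul_sub, hzr', mul_one, sub_zero]
    rw [e]
    exact (hrn.add hwwn).mul_left hzK
  · intro h0
    have : q * q' = q' := by
      have hqw : q * star w = star w := by
        have := congrArg star hwq
        rwa [star_mul, hq.isSelfAdjoint.star_eq] at this
      rw [hq', mul_sub, hq.isIdempotentElem.eq, ← mul_assoc, hqw]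
    rw [← this, ← mul_assoc, h0, zero_mul, this] at hzq'
    exact hq'0 hzq'.symm

/-- The central projections at which the trace is normal are jointly faithful. -/
theorem IsFaithfulTrace.eq_zero_of_central_mul (h : IsFaithfulTrace M τ) (hKM : ∀ x ∈ K, x ∈ M)
    {ξ : H} (hξ : ∀ z, IsNormalAt M K τ z → IsStarProjection z → z ∈ K.commutant → z ξ = 0) :
    ξ = 0 := by
  let Z := {z : H →L[ℂ] H // IsNormalAt M K τ z ∧ IsStarProjection z ∧ z ∈ K.commutant}
  let V : Submodule ℂ H := ⨅ z : Z, LinearMap.ker (z : H →L[ℂ] H).toLinearMap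
  have hVmem : ∀ v, v ∈ V ↔ ∀ z : Z, (z : H →L[ℂ] H) v = 0 := fun v => by
    simp only [V, LinearMap.mem_ker, Submodule.mem_iInf]
    rfl
  have hVc : IsClosed (V : Set H) := by
    simp only [V, Submodule.coe_iInf]
    exact isClosed_iInter fun z => (z : H →L[ℂ] H).isClosed_ker
  have : CompleteSpace V := hVc.completeSpace_coe
  have hinv : ∀ a : H →L[ℂ] H, (∀ z : Z, (z : H →L[ℂ] H) * a = a * z) → ∀ v ∈ V, a v ∈ V := by
    intro a ha v hv
    rw [hVmem] at hv ⊢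
    intro z
    have : (z : H →L[ℂ] H) (a v) = a ((z : H →L[ℂ] H) v) :=
      congrArg (fun T : H →L[ℂ] H => T v) (ha z)
    rw [this, hv z, map_zero]
  set p := V.starProjection
  have hpK : p ∈ K := K.starProjection_mem V fun a ha =>
    hinv a fun z => (VonNeumannAlgebra.mem_commutant_iff.1 ha) z z.2.1.1
  have hpK' : p ∈ K.commutant := K.commutant.starProjection_mem V fun a ha =>
    hinv a fun z => by
      rw [VonNeumannAlgebra.commutant_commutant] at ha
      exact ((VonNeumannAlgebra.mem_commutant_iff.1 z.2.2.2) a ha).symm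
  have hpp : IsStarProjection p := isStarProjection_starProjection
  by_contra hne
  obtain ⟨m, hmn, hm0, hmξ⟩ := h.exists_isNormalAt hKM hne
  have hcomm : m * p = p * m := VonNeumannAlgebra.mem_commutant_iff.1 hpK' m hmn.1
  have hmp : 0 ≤ m * p := (show Commute m p from hcomm).mul_nonneg hm0 hpp.nonneg
  have hpξ : p ξ = ξ := V.starProjection_eq_self_iff.2
    ((hVmem ξ).2 fun z => hξ z z.2.1 z.2.2.1 z.2.2.2)
  have hmp0 : m * p ≠ 0 := by
    intro h0
    have : m (p ξ) = 0 := congrArg (fun T : H →L[ℂ] H => T ξ) h0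
    rw [hpξ] at this
    exact hmξ this
  obtain ⟨q, c, hq, hq0, hqn, hqc⟩ :=
    (hmn.mul_right h hKM hpK).exists_isStarProjection hmp hmp0
  obtain ⟨z, hzn, hz, hzK', hzq⟩ := hqn.exists_central h hKM hq hq0
  have hzp : z * p = 0 := by
    ext v
    exact (hVmem _).1 (V.starProjection_apply_mem v) ⟨z, hzn, hz, hzK'⟩
  apply hzq
  rw [hqc, hcomm, mul_assoc, ← mul_assoc, hzp, zero_mul]

end Central

section Main

open Filter Topology InnerProductSpace

variable {H : Type*} [NormedAddCommGroup H] [InnerProductSpace ℂ H] [CompleteSpace H]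
  {M K : VonNeumannAlgebra H} {τ : (H →L[ℂ] H) →ₗ[ℂ] ℂ}

/-- An operator commutes with a von Neumann algebra as soon as it commutes with its unitaries. -/
theorem VonNeumannAlgebra.commute_of_unitary (L : VonNeumannAlgebra H) {x : H →L[ℂ] H}
    (hx : ∀ u ∈ L, u ∈ unitary (H →L[ℂ] H) → x * u = u * x) : ∀ k ∈ L, x * k = k * x := by
  intro k hk
  have hcl : IsClosed (L.toStarSubalgebra : Set (H →L[ℂ] H)) := by
    have : (L.toStarSubalgebra : Set (H →L[ℂ] H)) =
        Set.centralizer (Set.centralizer (L : Set (H →L[ℂ] H))) := L.centralizer_centralizer.symm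
    rw [this]
    exact Set.isClosed_centralizer _
  have hk' : (⟨k, hk⟩ : L.toStarSubalgebra) ∈
      Submodule.span ℂ (unitary L.toStarSubalgebra : Set _) := by
    rw [CStarAlgebra.span_unitary]; trivial
  have key : ∀ y : L.toStarSubalgebra, y ∈ Submodule.span ℂ (unitary L.toStarSubalgebra : Set _) →
      x * (y : H →L[ℂ] H) = y * x := by
    intro y hy
    induction hy using Submodule.span_induction with
    | mem u hu =>
      exact hx u u.2 ⟨congrArg Subtype.val hu.1, congrArg Subtype.val hu.2⟩
    | zero => simp
    | add a b _ _ ha hb => simp [mul_add, add_mul, ha, hb]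
    | smul c a _ ha => simp [ha]
  exact key _ hk'

namespace IsFaithfulTrace

theorem parallelogram (x y : H →L[ℂ] H) :
    τ (star (x + y) * (x + y)) + τ (star (x - y) * (x - y)) =
      2 * τ (star x * x) + 2 * τ (star y * y) := by
  simp only [star_add, star_sub, add_mul, sub_mul, mul_add, mul_sub, map_add, map_sub]
  ring

theorem lowerSemicontinuousOn (h : IsFaithfulTrace M τ) (hKM : ∀ x ∈ K, x ∈ M) {z : H →L[ℂ] H}
    (hz : IsNormalAt M K τ z) :
    LowerSemicontinuousOn (fun A : H →WOT[ℂ] H => (τ (star (A.toCLM * z) * (A.toCLM * z))).re)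
      {A | A.toCLM ∈ K} := by
  intro A hA y hy
  have hzM := hKM z hz.1
  have hAz : A.toCLM * z ∈ M := mul_mem (hKM _ hA) hzM
  obtain ⟨g, hg⟩ := hz.2 (star (A.toCLM * z)) (star_mem hAz) 1 (one_mem K)
  set t := (τ (star (A.toCLM * z) * (A.toCLM * z))).re with ht
  have hgA : (g A).re = t := by
    have := hg A.toCLM hA
    rw [one_mul, mul_assoc] at this
    rw [ht, this]
  have hev : ∀ᶠ B in 𝓝[{A : H →WOT[ℂ] H | A.toCLM ∈ K}] A, y < 2 * (g B).re - t := by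
    refine eventually_nhdsWithin_of_eventually_nhds ?_
    have hc : Continuous fun B : H →WOT[ℂ] H => 2 * (g B).re - t :=
      (continuous_const.mul (Complex.continuous_re.comp g.continuous)).sub continuous_const
    refine hc.continuousAt.eventually (lt_mem_nhds ?_)
    change y < 2 * (g A).re - t
    rw [hgA]
    have hy' : y < t := hy
    linarith
  filter_upwards [hev, self_mem_nhdsWithin] with B hB hBK
  refine hB.trans_le ?_
  have hBz : B.toCLM * z ∈ M := mul_mem (hKM _ hBK) hzM
  have h1 := (Complex.le_def.1 (h.pos _ (sub_mem hBz hAz))).1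
  have h2 : τ (star (A.toCLM * z) * (B.toCLM * z)) = g B := by
    have := hg B.toCLM hBK
    rw [one_mul, mul_assoc] at this
    exact this
  have h3 : τ (star (B.toCLM * z) * (A.toCLM * z)) = star (g B) := by
    have := h.map_star (mul_mem (star_mem hAz) hBz)
    rw [h2, star_mul, star_star] at this
    exact this
  rw [star_sub, sub_mul, mul_sub, mul_sub, map_sub, map_sub, map_sub, h2, h3] at h1
  simp only [Complex.zero_re, Complex.sub_re, Complex.star_def, Complex.conj_re] at h1
  rw [← ht] at h1
  linarith

/-- Averaging over the unitaries of `L`: below a central projection at which the trace is normal,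
an element of `K` has the same trace pairings with `L' ∩ M` as some element commuting with `L`. -/
theorem exists_commute (h : IsFaithfulTrace M τ) (hKM : ∀ x ∈ K, x ∈ M)
    {L : VonNeumannAlgebra H} (hLK : ∀ x ∈ L, x ∈ K) {z e : H →L[ℂ] H} (hz : IsNormalAt M K τ z)
    (hzK : z ∈ K.commutant) (he : e ∈ K) :
    ∃ c ∈ K, (∀ k ∈ L, c * z * k = k * (c * z)) ∧
      ∀ x ∈ M, (∀ k ∈ L, x * k = k * x) → τ (x * (c * z)) = τ (x * (e * z)) := by
  have hzc : ∀ a ∈ K, a * z = z * a := VonNeumannAlgebra.mem_commutant_iff.1 hzK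
  have hzM := hKM z hz.1
  let S₀ : Set (H →L[ℂ] H) := {c | (c ∈ K ∧ ‖c‖ ≤ ‖e‖) ∧
      ∀ x ∈ M, (∀ k ∈ L, x * k = k * x) → τ (x * (c * z)) = τ (x * (e * z))}
  let S : Set (H →WOT[ℂ] H) := {A | A.toCLM ∈ S₀}
  have hS : IsCompact S := by
    have : S = {A | A.toCLM ∈ K ∧ ‖A.toCLM‖ ≤ ‖e‖} ∩
        ⋂ x ∈ {x | x ∈ M ∧ ∀ k ∈ L, x * k = k * x},
          {A | A.toCLM ∈ K ∧ τ (x * (A.toCLM * z)) = τ (x * (e * z))} := by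
      ext A
      simp only [S, S₀, Set.mem_ofPred_eq, Set.mem_inter_iff, Set.mem_iInter]
      exact ⟨fun hA => ⟨hA.1, fun x hx => ⟨hA.1.1, hA.2 x hx.1 hx.2⟩⟩,
        fun hA => ⟨hA.1, fun x hx hx' => (hA.2 x ⟨hx, hx'⟩).2⟩⟩
    rw [this]
    refine (K.isCompact_wot_ball _).inter_right (isClosed_biInter fun x hx => ?_)
    obtain ⟨g, hg⟩ := hz.2 x hx.1 1 (one_mem K)
    have : {A : H →WOT[ℂ] H | A.toCLM ∈ K ∧ τ (x * (A.toCLM * z)) = τ (x * (e * z))} =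
        {A | A.toCLM ∈ K} ∩ {A | g A = τ (x * (e * z))} := by
      ext A
      refine and_congr_right fun hA => ?_
      have := hg A.toCLM hA
      rw [one_mul, mul_assoc] at this
      change _ ↔ g A = _
      rw [this]
    rw [this]
    exact K.isClosed_wot.inter (isClosed_eq g.continuous continuous_const)
  obtain ⟨A, hAS, hmin⟩ := LowerSemicontinuousOn.exists_isMinOn (s := S)
    ⟨.ofCLM e, ⟨he, le_rfl⟩, fun _ _ _ => rfl⟩ hS
    ((h.lowerSemicontinuousOn hKM hz).mono fun A hA => hA.1.1)
  set c := A.toCLM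
  obtain ⟨⟨hcK, hcn⟩, hcτ⟩ := hAS
  replace hmin : ∀ b ∈ S₀, (τ (star (c * z) * (c * z))).re ≤ (τ (star (b * z) * (b * z))).re :=
    fun b hb => hmin (show (.ofCLM b : H →WOT[ℂ] H) ∈ S from hb)
  refine ⟨c, hcK, L.commute_of_unitary fun u huL hu => ?_, hcτ⟩
  have huK := hLK u huL
  have huu : star u * u = 1 := hu.1
  have hcM := hKM c hcK
  have huM := hKM u huK
  set x := c * z with hx
  have hxM : x ∈ M := mul_mem hcM hzM
  set y := u * x * star u with hy
  have hyM : y ∈ M := mul_mem (mul_mem huM hxM) (star_mem huM)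
  have hyz : u * c * star u * z = y := by
    rw [hy, hx, mul_assoc _ (star u), hzc _ (star_mem huK)]
    simp only [mul_assoc]
  have hcu : u * c * star u ∈ S₀ := by
    refine ⟨⟨mul_mem (mul_mem huK hcK) (star_mem huK), ?_⟩, fun b hb hbL => ?_⟩
    · rw [CStarRing.norm_mul_mem_unitary _ (Unitary.star_mem hu),
        CStarRing.norm_mem_unitary_mul _ hu]
      exact hcn
    · rw [hyz, ← hcτ b hb hbL, hy, ← mul_assoc, h.comm _ (mul_mem hb (mul_mem huM hxM)) _
        (star_mem huM), ← mul_assoc b, hbL u huL, mul_assoc u, ← mul_assoc (star u), huu, one_mul]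
  have hmid : (2⁻¹ : ℂ) • (c + u * c * star u) ∈ S₀ := by
    refine ⟨⟨K.complex_smul_mem _ (add_mem hcK hcu.1.1), ?_⟩, fun b hb hbL => ?_⟩
    · rw [norm_smul]
      have := norm_add_le c (u * c * star u)
      have h1 := hcu.1.2
      have h2 : ‖(2⁻¹ : ℂ)‖ = 2⁻¹ := by simp
      rw [h2]
      linarith
    · rw [smul_mul_assoc, mul_smul_comm, add_mul, mul_add, map_smul, map_add, hcτ b hb hbL,
        hcu.2 b hb hbL, smul_eq_mul]
      ring
  have h1 := hmin _ hmid
  rw [smul_mul_assoc, add_mul, hyz, ← hx] at h1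
  have h2 : τ (star y * y) = τ (star x * x) := by
    have : star y * y = u * (star x * x) * star u := by
      rw [hy, star_mul, star_mul, star_star]
      calc _ = u * (star x * ((star u * u) * x)) * star u := by simp only [mul_assoc]
        _ = _ := by rw [huu, one_mul]
    rw [this, h.comm _ (mul_mem huM (mul_mem (star_mem hxM) hxM)) _ (star_mem huM), ← mul_assoc,
      huu, one_mul]
  have h3 := parallelogram (τ := τ) x y
  have h4 : τ (star ((2⁻¹ : ℂ) • (x + y)) * ((2⁻¹ : ℂ) • (x + y))) =
      4⁻¹ * τ (star (x + y) * (x + y)) := by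
    rw [star_smul, smul_mul_smul_comm, map_smul, smul_eq_mul]
    congr 1
    simp
    norm_num
  have h5 := Complex.le_def.1 (h.pos _ (sub_mem hxM hyM))
  have h6 : τ (star (x - y) * (x - y)) = 0 := by
    refine Complex.ext (le_antisymm ?_ h5.1) h5.2.symm
    have h7 := congrArg Complex.re h3
    rw [h4] at h1
    have h8 : (4⁻¹ * τ (star (x + y) * (x + y))).re = 4⁻¹ * (τ (star (x + y) * (x + y))).re := by
      have : (4⁻¹ : ℂ) = ((4⁻¹ : ℝ) : ℂ) := by simp
      rw [this, Complex.re_ofReal_mul]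
    rw [h8] at h1
    rw [h2] at h7
    simp only [Complex.add_re, Complex.mul_re, Complex.re_ofNat, Complex.im_ofNat, zero_mul,
      sub_zero] at h7
    change (τ (star (x - y) * (x - y))).re ≤ 0
    linarith
  have h9 : x = y := sub_eq_zero.1 (h.faithful _ (sub_mem hxM hyM) h6)
  conv_lhs => rw [h9, hy, mul_assoc, huu, mul_one]

end IsFaithfulTrace

end Main

/-- For von Neumann subalgebras `N ⊆ K ⊆ K₁ ⊆ M₁` of a von Neumann algebra
`M₁` with faithful tracial state `τ`, assuming the `τ`-preserving conditional expectations
onto `N'∩K₁`, `K'∩K₁`, `N'∩M₁` and `K'∩M₁` exist, the quadruple with top row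
`K'∩M₁ ⊆ N'∩M₁` and bottom row `K'∩K₁ ⊆ N'∩K₁` is a commuting square: for every
`x ∈ K'∩M₁`, `E_{N'∩K₁}(x) ∈ K'∩K₁` and `E_{N'∩K₁}(x) = E_{K'∩K₁}(x)`. -/
theorem stmt_15
    {H : Type*} [NormedAddCommGroup H] [InnerProductSpace ℂ H] [CompleteSpace H]
    (M1 K1 K N : VonNeumannAlgebra H)
    (hNK : ∀ x, x ∈ N → x ∈ K) (hKK1 : ∀ x, x ∈ K → x ∈ K1)
    (hK1M1 : ∀ x, x ∈ K1 → x ∈ M1)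
    (τ : (H →L[ℂ] H) →ₗ[ℂ] ℂ)
    (hτ1 : τ 1 = 1)
    (hτpos : ∀ x ∈ M1, 0 ≤ τ (star x * x))
    (hτfaith : ∀ x ∈ M1, τ (star x * x) = 0 → x = 0)
    (hτtr : ∀ x ∈ M1, ∀ y ∈ M1, τ (x * y) = τ (y * x))
    -- the `τ`-preserving conditional expectations onto the four relative commutants:
    (ENK1 EKK1 ENM1 EKM1 : (H →L[ℂ] H) →ₗ[ℂ] (H →L[ℂ] H))
    (hENK1mem : ∀ x ∈ M1, ENK1 x ∈ K1 ∧ ∀ n ∈ N, ENK1 x * n = n * ENK1 x)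
    (hENK1 : ∀ x ∈ M1, ∀ y, (y ∈ K1 ∧ ∀ n ∈ N, y * n = n * y) →
      τ (ENK1 x * y) = τ (x * y))
    (hEKK1mem : ∀ x ∈ M1, EKK1 x ∈ K1 ∧ ∀ k ∈ K, EKK1 x * k = k * EKK1 x)
    (hEKK1 : ∀ x ∈ M1, ∀ y, (y ∈ K1 ∧ ∀ k ∈ K, y * k = k * y) →
      τ (EKK1 x * y) = τ (x * y))
    (hENM1mem : ∀ x ∈ M1, ENM1 x ∈ M1 ∧ ∀ n ∈ N, ENM1 x * n = n * ENM1 x)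
    (hENM1 : ∀ x ∈ M1, ∀ y, (y ∈ M1 ∧ ∀ n ∈ N, y * n = n * y) →
      τ (ENM1 x * y) = τ (x * y))
    (hEKM1mem : ∀ x ∈ M1, EKM1 x ∈ M1 ∧ ∀ k ∈ K, EKM1 x * k = k * EKM1 x)
    (hEKM1 : ∀ x ∈ M1, ∀ y, (y ∈ M1 ∧ ∀ k ∈ K, y * k = k * y) →
      τ (EKM1 x * y) = τ (x * y)) :
    ∀ x, (x ∈ M1 ∧ ∀ k ∈ K, x * k = k * x) →
      (ENK1 x ∈ K1 ∧ ∀ k ∈ K, ENK1 x * k = k * ENK1 x) ∧ ENK1 x = EKK1 x := by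
  intro x hx
  have h : IsFaithfulTrace M1 τ := ⟨hτpos, hτfaith, hτtr⟩
  obtain ⟨heK1, heN⟩ := hENK1mem x hx.1
  obtain ⟨hfK1, hfK⟩ := hEKK1mem x hx.1
  set e := ENK1 x
  set f := EKK1 x
  have heM := hK1M1 e heK1
  have hstar : ∀ b : H →L[ℂ] H, (∀ k ∈ K, b * k = k * b) → ∀ k ∈ K, star b * k = k * star b := by
    intro b hb k hk
    have := congrArg star (hb (star k) (star_mem hk))
    simpa using this.symm
  have hstarN : ∀ b : H →L[ℂ] H, (∀ n ∈ N, b * n = n * b) → ∀ n ∈ N, star b * n = n * star b := by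
    intro b hb n hn
    have := congrArg star (hb (star n) (star_mem hn))
    simpa using this.symm
  have heK : ∀ k ∈ K, e * k = k * e := by
    intro k hk
    refine sub_eq_zero.1 (ContinuousLinearMap.ext fun v => ?_)
    refine h.eq_zero_of_central_mul hK1M1 fun z hz hzp hzK' => ?_
    have hzc : ∀ a ∈ K1, a * z = z * a := VonNeumannAlgebra.mem_commutant_iff.1 hzK'
    have hzM := hK1M1 z hz.1
    obtain ⟨c, hcK1, hcK, hcτ⟩ := h.exists_commute hK1M1 hKK1 hz hzK' heK1
    have hczM : c * z ∈ M1 := hK1M1 _ (mul_mem hcK1 hz.1)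
    set a := e * z - c * z with ha
    have haK1 : a ∈ K1 := sub_mem (mul_mem heK1 hz.1) (mul_mem hcK1 hz.1)
    have haM := hK1M1 a haK1
    have haN : ∀ n ∈ N, a * n = n * a := by
      intro n hn
      rw [ha, sub_mul, mul_sub, hcK n (hNK n hn), mul_assoc, ← hzc n (hKK1 n (hNK n hn)),
        ← mul_assoc, heN n hn, mul_assoc]
    have hτa : ∀ b ∈ M1, (∀ k ∈ K, b * k = k * b) → τ (b * a) = 0 := by
      intro b hb hbK
      rw [ha, mul_sub, map_sub, hcτ b hb hbK, sub_self]
    have haz : a * z = a := by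
      rw [ha, sub_mul, mul_assoc, mul_assoc, hzp.isIdempotentElem.eq]
    have h1 := hENK1 x hx.1 (star a) ⟨star_mem haK1, hstarN a haN⟩
    have h2 : τ (a * star e) = 0 := by
      have e1 := h.map_star (mul_mem heM (star_mem haM))
      have e2 := h.map_star (mul_mem hx.1 (star_mem haM))
      rw [star_mul, star_star] at e1 e2
      rw [e1, h1, ← e2, h.comm a haM _ (star_mem hx.1), hτa _ (star_mem hx.1) (hstar x hx.2)]
    have h3 : τ (star (e * z) * a) = 0 := by
      rw [star_mul, hzp.isSelfAdjoint.star_eq, mul_assoc, h.comm z hzM _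
        (mul_mem (star_mem heM) haM), mul_assoc, haz, h.comm _ (star_mem heM) a haM, h2]
    have h4 : τ (star a * a) = 0 := by
      conv_lhs => enter [2, 1]; rw [ha]
      rw [star_sub, sub_mul, map_sub, h3, hτa _ (star_mem hczM) (hstar _ hcK), sub_self]
    have h5 : e * z = c * z := sub_eq_zero.1 (h.faithful a haM h4)
    have h6 : z * (e * k - k * e) = 0 := by
      have hkK1 := hKK1 k hk
      rw [← hzc _ (sub_mem (mul_mem heK1 hkK1) (mul_mem hkK1 heK1)), sub_mul, mul_assoc, hzc k hkK1,
        ← mul_assoc, mul_assoc k, h5, hcK k hk, sub_self]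
    exact congrArg (fun T : H →L[ℂ] H => T v) h6
  refine ⟨⟨heK1, heK⟩, ?_⟩
  have hdK1 : e - f ∈ K1 := sub_mem heK1 hfK1
  have hdM := hK1M1 _ hdK1
  have hdK : ∀ k ∈ K, (e - f) * k = k * (e - f) := fun k hk => by
    rw [sub_mul, mul_sub, heK k hk, hfK k hk]
  have hsK := hstar _ hdK
  have h1 := hENK1 x hx.1 (star (e - f)) ⟨star_mem hdK1, fun n hn => hsK n (hNK n hn)⟩
  have h2 := hEKK1 x hx.1 (star (e - f)) ⟨star_mem hdK1, hsK⟩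
  refine sub_eq_zero.1 (h.faithful _ hdM ?_)
  rw [h.comm _ (star_mem hdM) _ hdM, sub_mul, map_sub, h1, h2, sub_self]
end

section
/- Let M₁ be a von Neumann algebra on a complex Hilbert space H with a faithful tracial state τ, and let N ⊆ K ⊆ K₁ ⊆ M₁ and N ⊆ L ⊆ M ⊆ M₁ be von Neumann subalgebras with K ⊆ M, and suppose N'∩K₁ ⊆ L'∩M₁ and K'∩K₁ ⊆ M'∩M₁. Assume the τ-preserving conditional expectations onto the relevant relative commutants exist. Then the quadruple with top row N'∩K₁ ⊆ L'∩M₁ and bottom row K'∩K₁ ⊆ M'∩M₁ is a commuting square: for every x ∈ M'∩M₁, E_{N'∩K₁}(x) ∈ K'∩K₁ and E_{N'∩K₁}(x) = E_{K'∩K₁}(x). -/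
open scoped ComplexOrder

namespace VonNeumannAlgebra

section

open scoped InnerProductSpace Topology
open Filter

variable {H : Type*} [NormedAddCommGroup H] [InnerProductSpace ℂ H] [CompleteSpace H]

/-- Closed norm balls of operators are compact in the weak operator topology. -/
theorem isCompact_wot_ball_s16 (r : ℝ) :
    IsCompact {A : H →WOT[ℂ] H | ‖A.toCLM‖ ≤ r} := by
  rw [isCompact_iff_ultrafilter_le_nhds]
  intro 𝒰 h𝒰
  rw [le_principal_iff] at h𝒰
  have hr : 0 ≤ r := by
    obtain ⟨A, hA⟩ := 𝒰.nonempty_of_mem h𝒰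
    exact (norm_nonneg _).trans hA
  have hbd : ∀ x y : H, ∀ᶠ A : H →WOT[ℂ] H in 𝒰, ‖⟪A x, y⟫_ℂ‖ ≤ r * ‖x‖ * ‖y‖ := by
    intro x y
    filter_upwards [h𝒰] with A hA
    calc ‖⟪A x, y⟫_ℂ‖ ≤ ‖A x‖ * ‖y‖ := norm_inner_le_norm _ _
      _ ≤ r * ‖x‖ * ‖y‖ := by
        gcongr
        exact A.toCLM.le_of_opNorm_le hA x
  have hlim : ∀ x y : H, ∃ c : ℂ, Tendsto (fun A : H →WOT[ℂ] H => ⟪A x, y⟫_ℂ) 𝒰 (𝓝 c) := by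
    intro x y
    have hc : IsCompact (Metric.closedBall (0 : ℂ) (r * ‖x‖ * ‖y‖)) := isCompact_closedBall _ _
    obtain ⟨c, -, hc⟩ := hc.ultrafilter_le_nhds (𝒰.map fun A : H →WOT[ℂ] H => ⟪A x, y⟫_ℂ) (by
      rw [le_principal_iff, Ultrafilter.mem_coe, Ultrafilter.mem_map]
      filter_upwards [hbd x y] with A hA
      simpa using hA)
    exact ⟨c, hc⟩
  choose f hf using hlim
  have hfbd : ∀ x y, ‖f x y‖ ≤ r * ‖x‖ * ‖y‖ := fun x y =>
    le_of_tendsto (hf x y).norm (hbd x y)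
  let B : H →ₗ⋆[ℂ] H →ₗ[ℂ] ℂ := LinearMap.mk₂'ₛₗ (starRingEnd ℂ) (RingHom.id ℂ) f
    (fun x x' y => tendsto_nhds_unique (hf _ _) <| by
      simpa only [map_add, inner_add_left] using (hf x y).add (hf x' y))
    (fun c x y => tendsto_nhds_unique (hf _ _) <| by
      simpa only [map_smul, inner_smul_left, smul_eq_mul] using (hf x y).const_mul _)
    (fun x y y' => tendsto_nhds_unique (hf _ _) <| by
      simpa only [inner_add_right] using (hf x y).add (hf x y'))
    (fun c x y => tendsto_nhds_unique (hf _ _) <| by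
      simpa only [inner_smul_right, smul_eq_mul, RingHom.id_apply] using (hf x y).const_mul _)
  let B' : H →L⋆[ℂ] H →L[ℂ] ℂ := LinearMap.mkContinuous₂ B r hfbd
  let T := InnerProductSpace.continuousLinearMapOfBilin B'
  have hT : ∀ x y, ⟪T x, y⟫_ℂ = f x y := fun x y =>
    InnerProductSpace.continuousLinearMapOfBilin_apply B' x y
  refine ⟨.ofCLM T, ?_, ?_⟩
  · refine ContinuousLinearMap.opNorm_le_of_unit_norm (𝕜 := ℂ) hr ?_
    intro x hx
    have h1 : ‖T x‖ * ‖T x‖ ≤ r * ‖T x‖ := by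
      have := hfbd x (T x)
      rw [← hT, inner_self_eq_norm_sq_to_K, hx, mul_one] at this
      simpa [sq] using this
    rcases eq_or_ne (T x) 0 with h0 | h0
    · simpa [h0] using hr
    · exact le_of_mul_le_mul_right h1 (norm_pos_iff.2 h0)
  · change Tendsto id _ _
    rw [ContinuousLinearMapWOT.tendsto_iff_forall_inner_apply_tendsto]
    intro x y
    have h1 := (hf x y).star
    have h2 : star (f x y) = ⟪y, T x⟫_ℂ := by
      rw [← hT]
      exact inner_conj_symm _ _
    rw [h2] at h1
    refine h1.congr fun A => ?_
    exact inner_conj_symm _ _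

theorem isClosed_wot_mem (S : VonNeumannAlgebra H) :
    IsClosed {A : H →WOT[ℂ] H | A.toCLM ∈ S} := by
  have : {A : H →WOT[ℂ] H | A.toCLM ∈ S} =
      ⋂ c ∈ S.commutant, {A : H →WOT[ℂ] H | .ofCLM c * A = A * .ofCLM c} := by
    ext A
    simp only [Set.mem_ofPred_eq, Set.mem_iInter]
    rw [← S.commutant_commutant, mem_commutant_iff, commutant_commutant]
    exact forall₂_congr fun c _ => (ContinuousLinearMapWOT.toCLM_injective.eq_iff
      (a := .ofCLM c * A) (b := A * .ofCLM c))
  rw [this]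
  exact isClosed_biInter fun c _ =>
    isClosed_eq (continuous_const_mul _) (continuous_mul_const _)

theorem isClosed_wot_nonneg : IsClosed {A : H →WOT[ℂ] H | 0 ≤ A.toCLM} := by
  have : {A : H →WOT[ℂ] H | 0 ≤ A.toCLM} = ⋂ x : H, {A : H →WOT[ℂ] H | 0 ≤ ⟪x, A x⟫_ℂ} := by
    ext A
    simp only [Set.mem_ofPred_eq, Set.mem_iInter]
    rw [ContinuousLinearMap.nonneg_iff_isPositive]
    refine ⟨fun h x => h.inner_nonneg_right x, fun h => ?_⟩
    rw [ContinuousLinearMap.isPositive_iff_complex]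
    intro x
    have hx : 0 ≤ ⟪A x, x⟫_ℂ := by
      rw [← inner_conj_symm]
      simpa using star_nonneg_iff.2 (h x)
    obtain ⟨h1, h2⟩ := Complex.nonneg_iff.1 hx
    exact ⟨Complex.ext rfl (by simpa using h2), h1⟩
  rw [this]
  exact isClosed_iInter fun x => isClosed_le continuous_const
    (ContinuousLinearMapWOT.continuous_inner_apply continuous_id x x)

theorem isClosed_coe (S : VonNeumannAlgebra H) : IsClosed (S : Set (H →L[ℂ] H)) :=
  S.isClosed_wot_mem.preimage ContinuousLinearMapWOT.continuous_ofCLM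

theorem smul_mem (S : VonNeumannAlgebra H) (c : ℂ) {a : H →L[ℂ] H} (ha : a ∈ S) : c • a ∈ S :=
  S.toStarSubalgebra.smul_mem ha c

theorem real_smul_mem_s16 (S : VonNeumannAlgebra H) (c : ℝ) {a : H →L[ℂ] H} (ha : a ∈ S) :
    c • a ∈ S := by
  rw [← Complex.coe_smul]
  exact S.smul_mem _ ha

theorem algebraMap_mem (S : VonNeumannAlgebra H) (c : ℝ) :
    algebraMap ℝ (H →L[ℂ] H) c ∈ S := by
  rw [Algebra.algebraMap_eq_smul_one]
  exact S.real_smul_mem_s16 c (one_mem S)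

theorem cfc_mem_s16 (S : VonNeumannAlgebra H) (f : ℝ → ℝ) {a : H →L[ℂ] H} (ha : a ∈ S)
    (hsa : IsSelfAdjoint a) : cfc f a ∈ S := by
  rw [← S.commutant_commutant, mem_commutant_iff]
  intro c hc
  have hac : Commute a c := mem_commutant_iff.1 hc a ha
  exact (hac.cfc (by rwa [hsa.star_eq]) f).symm.eq

theorem sqrt_mem (S : VonNeumannAlgebra H) {a : H →L[ℂ] H} (ha : a ∈ S) (h0 : 0 ≤ a) :
    CFC.sqrt a ∈ S := by
  rw [CFC.sqrt_eq_real_sqrt a h0, cfcₙ_eq_cfc]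
  exact S.cfc_mem_s16 _ ha h0.isSelfAdjoint

theorem posPart_mem (S : VonNeumannAlgebra H) {a : H →L[ℂ] H} (ha : a ∈ S)
    (hsa : IsSelfAdjoint a) : a⁺ ∈ S := by
  rw [CFC.posPart_def, cfcₙ_eq_cfc]
  exact S.cfc_mem_s16 _ ha hsa

/-- The orthogonal projection onto a closed subspace invariant under the commutant of `S`
belongs to `S`. -/
theorem starProjection_mem_s16 (S : VonNeumannAlgebra H) (U : Submodule ℂ H)
    [U.HasOrthogonalProjection] (hU : ∀ c ∈ S.commutant, ∀ x ∈ U, c x ∈ U) :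
    U.starProjection ∈ S := by
  rw [IsStarProjection.mem_iff isStarProjection_starProjection]
  intro c hc
  rw [Submodule.range_starProjection]
  exact fun x hx => hU c hc x hx

theorem norm_le_of_mem_Icc {x : H →L[ℂ] H} {r : ℝ} (hr : 0 ≤ r) (hx : IsSelfAdjoint x)
    (h1 : x ≤ algebraMap ℝ _ r) (h2 : -algebraMap ℝ _ r ≤ x) : ‖x‖ ≤ r := by
  rw [← map_neg] at h2
  rw [le_algebraMap_iff_spectrum_le] at h1
  rw [algebraMap_le_iff_le_spectrum] at h2
  rw [← cfc_id' ℝ x]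
  exact norm_cfc_le hr fun t ht => abs_le.2 ⟨h2 t ht, h1 t ht⟩

theorem exists_proj (S : VonNeumannAlgebra H) (V : Submodule ℂ H)
    (hV : ∀ c ∈ S.commutant, ∀ x ∈ V, c x ∈ V) :
    ∃ p ∈ S, IsStarProjection p ∧ (∀ v ∈ V, p v = v) ∧
      ∀ y : H →L[ℂ] H, (∀ v ∈ V, y v = 0) → y * p = 0 := by
  refine ⟨V.topologicalClosure.starProjection, S.starProjection_mem_s16 _ fun c hc x hx => ?_,
    isStarProjection_starProjection, fun v hv => ?_, fun y hy => ?_⟩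
  · have : Set.MapsTo c (closure (V : Set H)) (closure (V : Set H)) :=
      Set.MapsTo.closure (fun x hx => hV c hc x hx) c.continuous
    exact this hx
  · exact Submodule.starProjection_eq_self_iff.2 (V.le_topologicalClosure hv)
  · ext z
    have : V.topologicalClosure ≤ LinearMap.ker (y : H →ₗ[ℂ] H) :=
      V.topologicalClosure_minimal (fun v hv => hy v hv) y.isClosed_ker
    exact this (V.topologicalClosure.starProjection_apply_mem z)

/-- A self-adjoint contraction lies between `-(1 - p)` and `p` for a projection `p`. -/
theorem exists_proj_bound (S : VonNeumannAlgebra H) {a : H →L[ℂ] H} (ha : a ∈ S)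
    (hsa : IsSelfAdjoint a) (hn : ‖a‖ ≤ 1) :
    ∃ p ∈ S, IsStarProjection p ∧ a ≤ p ∧ -(1 - p) ≤ a := by
  have hpos : a⁺ ∈ S := S.posPart_mem ha hsa
  obtain ⟨p, hpS, hp, hp1, hp2⟩ :=
      S.exists_proj (LinearMap.range ((a⁺ : H →L[ℂ] H) : H →ₗ[ℂ] H)) (by
    rintro c hc _ ⟨x, rfl⟩
    refine ⟨c x, ?_⟩
    have := congrArg (fun f : H →L[ℂ] H => f x) (mem_commutant_iff.1 hc _ hpos)
    exact this)
  have e1 : p * a⁺ = a⁺ := by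
    ext x
    exact hp1 _ ⟨x, rfl⟩
  have e2 : a⁻ * p = 0 := hp2 _ (by
    rintro _ ⟨x, rfl⟩
    have := congrArg (fun f : H →L[ℂ] H => f x) (CFC.negPart_mul_posPart a)
    exact this)
  have s1 : star a⁺ = a⁺ := (CFC.posPart_nonneg a).isSelfAdjoint.star_eq
  have s2 : star a⁻ = a⁻ := (CFC.negPart_nonneg a).isSelfAdjoint.star_eq
  have e1' : a⁺ * p = a⁺ := by simpa [s1, hp.isSelfAdjoint.star_eq] using congrArg star e1
  have e2' : p * a⁻ = 0 := by simpa [s2, hp.isSelfAdjoint.star_eq] using congrArg star e2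
  have n1 : a⁺ ≤ 1 := by
    rw [← CStarAlgebra.norm_le_one_iff_of_nonneg _ (CFC.posPart_nonneg a)]
    exact (CStarAlgebra.norm_posPart_le a).trans hn
  have n2 : a⁻ ≤ 1 := by
    rw [← CStarAlgebra.norm_le_one_iff_of_nonneg _ (CFC.negPart_nonneg a)]
    exact (CStarAlgebra.norm_negPart_le a).trans hn
  have d := CFC.posPart_sub_negPart a hsa
  have le1 : a⁺ ≤ p := by
    have := star_left_conjugate_le_conjugate n1 p
    rw [hp.isSelfAdjoint.star_eq, e1, e1', mul_one, hp.isIdempotentElem.eq] at this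
    exact this
  have le2 : a⁻ ≤ 1 - p := by
    have := star_left_conjugate_le_conjugate n2 (1 - p)
    rw [hp.one_sub.isSelfAdjoint.star_eq, mul_one, hp.one_sub.isIdempotentElem.eq] at this
    rwa [sub_mul, one_mul, e2', sub_zero, mul_sub, e2, mul_one, sub_zero] at this
  refine ⟨p, hpS, hp, ?_, ?_⟩
  · exact (d.symm.le.trans (sub_le_self _ (CFC.negPart_nonneg a))).trans le1
  · refine (neg_le_neg le2).trans (le_trans ?_ d.le)
    rw [sub_eq_add_neg]
    exact le_add_of_nonneg_left (CFC.posPart_nonneg a)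

theorem norm_le_one_of_star_mul_self_le {a : H →L[ℂ] H} (h : star a * a ≤ 1) : ‖a‖ ≤ 1 := by
  rw [← CStarAlgebra.norm_le_one_iff_of_nonneg _ (star_mul_self_nonneg a),
    CStarRing.norm_star_mul_self] at h
  nlinarith [norm_nonneg a]

theorem star_mul_self_le_one {a : H →L[ℂ] H} (h : ‖a‖ ≤ 1) : star a * a ≤ 1 := by
  rw [← CStarAlgebra.norm_le_one_iff_of_nonneg _ (star_mul_self_nonneg a),
    CStarRing.norm_star_mul_self]
  nlinarith [norm_nonneg a]

/-- A maximal partial isometry in the corner `(1 - p) S p`. -/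
theorem exists_partialIsometry (S : VonNeumannAlgebra H) {p : H →L[ℂ] H} (hpS : p ∈ S)
    (hp : IsStarProjection p) :
    ∃ v ∈ S, (1 - p) * v * p = v ∧ v * star v * v = v ∧
      ∀ w ∈ S, (1 - p - v * star v) * w * (p - star v * v) = 0 := by
  set q := 1 - p with hq
  have hqS : q ∈ S := sub_mem (one_mem S) hpS
  let X : Set (H →WOT[ℂ] H) :=
    {A | A.toCLM ∈ S} ∩ {A | .ofCLM q * A * .ofCLM p = A} ∩ {A | ‖A.toCLM‖ ≤ 1}
  have hX : IsCompact X := (isCompact_wot_ball_s16 1).inter_left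
    ((isClosed_wot_mem S).inter (isClosed_eq
      ((continuous_mul_const _).comp (continuous_const_mul _)) continuous_id))
  have hX0 : X.Nonempty := ⟨0, ⟨by simp [zero_mem], by simp⟩, by simp⟩
  obtain ⟨V, hV⟩ := hX.extremePoints_nonempty hX0
  rw [mem_extremePoints_iff_left] at hV
  obtain ⟨⟨⟨hvS, hqvp⟩, hvn⟩, hext⟩ := hV
  set v := V.toCLM with hv
  have hqvp : q * v * p = v := congrArg ContinuousLinearMapWOT.toCLM hqvp
  have hvn : ‖v‖ ≤ 1 := hvn
  have hvS : v ∈ S := hvS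
  have key : ∀ y ∈ S, q * y * p = y → ‖v + y‖ ≤ 1 → ‖v - y‖ ≤ 1 → y = 0 := by
    intro y hy h1 h2 h3
    have := hext (.ofCLM (v + y))
      ⟨⟨add_mem hvS hy, ?_⟩, h2⟩ (.ofCLM (v - y)) ⟨⟨sub_mem hvS hy, ?_⟩, h3⟩ ?_
    · have := congrArg ContinuousLinearMapWOT.toCLM this
      exact add_eq_left.1 (this : v + y = v)
    · apply ContinuousLinearMapWOT.toCLM_injective
      change q * (v + y) * p = v + y
      rw [mul_add, add_mul, hqvp, h1]
    · apply ContinuousLinearMapWOT.toCLM_injective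
      change q * (v - y) * p = v - y
      rw [mul_sub, sub_mul, hqvp, h1]
    · refine ⟨1 / 2, 1 / 2, by norm_num, by norm_num, by norm_num, ?_⟩
      apply ContinuousLinearMapWOT.toCLM_injective
      change (1 / 2 : ℝ) • (v + y) + (1 / 2 : ℝ) • (v - y) = v
      module
  have hpp : p * p = p := hp.isIdempotentElem
  have hps : star p = p := hp.isSelfAdjoint
  have hqs : star q = q := hp.one_sub.isSelfAdjoint
  have hqq : q * q = q := hp.one_sub.isIdempotentElem
  have hqv : q * v = v := by rw [← hqvp, ← mul_assoc, ← mul_assoc, hqq]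
  have hvp : v * p = v := by rw [← hqvp, mul_assoc, hpp]
  have hpv' : p * star v = star v := by simpa [hps] using congrArg star hvp
  have hv'q : star v * q = star v := by simpa [hqs] using congrArg star hqv
  have hv'S : star v ∈ S := star_mem hvS
  set h := star v * v with hh
  have hS : h ∈ S := mul_mem hv'S hvS
  have hhs : star h = h := by simp [hh]
  have hh0 : 0 ≤ h := star_mul_self_nonneg v
  have hh1 : h ≤ 1 := star_mul_self_le_one hvn
  have hhp : h * p = h := by rw [hh, mul_assoc, hvp]
  have hph : p * h = h := by rw [hh, ← mul_assoc, hpv']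
  have hvvv : v * h = v := by
    have := key ((1 / 2 : ℝ) • (v - v * h)) (S.real_smul_mem_s16 _ (sub_mem hvS (mul_mem hvS hS)))
      (by rw [mul_smul_comm, smul_mul_assoc, mul_sub, sub_mul, hqvp, ← mul_assoc, hqv, mul_assoc,
        hhp]) ?_ ?_
    · rw [smul_eq_zero_iff_right (by norm_num), sub_eq_zero] at this
      exact this.symm
    · have e : v + (1 / 2 : ℝ) • (v - v * h) = (1 / 2 : ℝ) • (v * (3 - h)) := by
        rw [mul_sub, show v * 3 = v + v + v by noncomm_ring]
        module
      have : (4 : H →L[ℂ] H) - (3 - h) * h * (3 - h) = star (1 - h) * (4 - h) * (1 - h) := by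
        rw [star_sub, hhs, star_one]
        noncomm_ring
        rw [show (4 : H →L[ℂ] H) = (4 : ℕ) • 1 by simp]
        abel
      have h4 : (0 : H →L[ℂ] H) ≤ 4 - h := by
        rw [sub_nonneg]
        refine hh1.trans ?_
        have : algebraMap ℝ (H →L[ℂ] H) 1 ≤ algebraMap ℝ _ 4 :=
          algebraMap_mono _ (by norm_num)
        rwa [map_one, map_ofNat] at this
      have h5 := star_left_conjugate_nonneg h4 (1 - h)
      rw [← this, sub_nonneg] at h5
      rw [e]
      apply norm_le_one_of_star_mul_self_le
      have e2 : star ((1 / 2 : ℝ) • (v * (3 - h))) * ((1 / 2 : ℝ) • (v * (3 - h))) =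
          (1 / 4 : ℝ) • ((3 - h) * h * (3 - h)) := by
        rw [star_smul, star_mul, star_sub, hhs, show star (3 : H →L[ℂ] H) = 3 from star_ofNat 3,
          smul_mul_smul_comm, hh]
        simp only [mul_assoc, star_trivial]
        norm_num
      rw [e2]
      calc (1 / 4 : ℝ) • ((3 - h) * h * (3 - h)) ≤ (1 / 4 : ℝ) • (4 : H →L[ℂ] H) := by
            gcongr
        _ = 1 := by
            rw [← map_ofNat (algebraMap ℝ (H →L[ℂ] H)) 4, Algebra.algebraMap_eq_smul_one,
              smul_smul]
            norm_num
    · have e : v - (1 / 2 : ℝ) • (v - v * h) = (1 / 2 : ℝ) • (v + v * h) := by module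
      rw [e, norm_smul]
      have : ‖v * h‖ ≤ 1 := by
        refine (norm_mul_le _ _).trans ?_
        have := (CStarAlgebra.norm_le_one_iff_of_nonneg _ hh0).2 hh1
        nlinarith [norm_nonneg v, norm_nonneg h]
      have := norm_add_le v (v * h)
      norm_num
      linarith
  have hvvv' : h * star v = star v := by simpa [hhs] using congrArg star hvvv
  have hhh : h * h = h := by
    conv_lhs => rw [hh, mul_assoc, hvvv]
  refine ⟨v, hvS, hqvp, by rw [mul_assoc, hvvv], fun w hw => ?_⟩
  set r := p - h with hr
  have hrs : star r = r := by rw [hr, star_sub, hps, hhs]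
  have hrr : r * r = r := by
    rw [hr, mul_sub, sub_mul, sub_mul, hpp, hhp, hph, hhh, sub_self, sub_zero]
  set y := (q - v * star v) * w * r with hy
  have hrS : r ∈ S := sub_mem hpS hS
  have hyS : y ∈ S := mul_mem (mul_mem (sub_mem hqS (mul_mem hvS hv'S)) hw) hrS
  have hyr : y * r = y := by rw [hy, mul_assoc, hrr]
  have hqy : q * y = y := by
    rw [hy, ← mul_assoc, ← mul_assoc, mul_sub q, hqq, ← mul_assoc q, hqv]
  have hyp : y * p = y := by
    rw [hy, mul_assoc, hr, sub_mul p, hpp, hhp]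
  have hv'y : star v * y = 0 := by
    rw [hy, ← mul_assoc, ← mul_assoc, mul_sub (star v), hv'q, ← mul_assoc (star v) v, ← hh, hvvv',
      sub_self,
      zero_mul, zero_mul]
  have hy'v : star y * v = 0 := by simpa using congrArg star hv'y
  have scaled : ∀ c : ℝ, ‖c • y‖ ≤ 1 → c • y = 0 := by
    intro c hc
    set z := c • y with hz
    have hv'z : star v * z = 0 := by rw [hz, mul_smul_comm, hv'y, smul_zero]
    have hz'v : star z * v = 0 := by simpa using congrArg star hv'z
    have hzr : z * r = z := by rw [hz, smul_mul_assoc, hyr]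
    have hz'r : r * star z = star z := by simpa [hrs] using congrArg star hzr
    have hzz : star z * z ≤ r := by
      have := star_left_conjugate_le_conjugate (star_mul_self_le_one hc) r
      rwa [hrs, mul_one, hrr, ← mul_assoc, hz'r, mul_assoc, hzr] at this
    have hle : h + star z * z ≤ 1 := by
      calc h + star z * z ≤ h + r := by gcongr
        _ = p := by rw [hr]; abel
        _ ≤ 1 := hp.le_one
    refine key z (S.real_smul_mem_s16 _ hyS) ?_ ?_ ?_
    · rw [hz, mul_smul_comm, smul_mul_assoc, hqy, hyp]
    · apply norm_le_one_of_star_mul_self_le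
      rwa [star_add, mul_add, add_mul, add_mul, hv'z, hz'v, add_zero, zero_add]
    · apply norm_le_one_of_star_mul_self_le
      rwa [star_sub, mul_sub, sub_mul, sub_mul, hv'z, hz'v, sub_zero, zero_sub, sub_neg_eq_add]
  by_contra hy0
  have hn : 0 < ‖y‖ := norm_pos_iff.2 hy0
  have := scaled (‖y‖⁻¹) (by rw [norm_smul]; simp [hn.ne'])
  rw [smul_eq_zero_iff_right (inv_ne_zero hn.ne')] at this
  exact hy0 this

/-- The central support of a projection `e` of `S` is orthogonal to every projection `f` with
`f S e = 0`. -/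
theorem exists_central_proj (S : VonNeumannAlgebra H) {e f : H →L[ℂ] H} (heS : e ∈ S)
    (hf : ∀ m ∈ S, f * m * e = 0) :
    ∃ g ∈ S, IsStarProjection g ∧ (∀ m ∈ S, m * g = g * m) ∧ g * e = e ∧ f * g = 0 := by
  let V : Submodule ℂ H := Submodule.span ℂ {x | ∃ m ∈ S, ∃ ξ, x = m (e ξ)}
  have hVS : ∀ m ∈ S, ∀ x ∈ V, m x ∈ V := by
    intro m hm x hx
    induction hx using Submodule.span_induction with
    | mem x hx =>
      obtain ⟨n, hn, ξ, rfl⟩ := hx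
      exact Submodule.subset_span ⟨m * n, mul_mem hm hn, ξ, rfl⟩
    | zero => simp
    | add x y _ _ hx hy => rw [map_add]; exact V.add_mem hx hy
    | smul c x _ hx => rw [map_smul]; exact V.smul_mem c hx
  have hVS' : ∀ c ∈ S.commutant, ∀ x ∈ V, c x ∈ V := by
    intro c hc x hx
    induction hx using Submodule.span_induction with
    | mem x hx =>
      obtain ⟨n, hn, ξ, rfl⟩ := hx
      refine Submodule.subset_span ⟨n, hn, c ξ, ?_⟩
      have := congrArg (fun f : H →L[ℂ] H => f ξ)
        (mem_commutant_iff.1 hc (n * e) (mul_mem hn heS))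
      exact this.symm
    | zero => simp
    | add x y _ _ hx hy => rw [map_add]; exact V.add_mem hx hy
    | smul c x _ hx => rw [map_smul]; exact V.smul_mem _ hx
  obtain ⟨g, hgS, hg, hg1, hg2⟩ := S.exists_proj V hVS'
  have hgs : star g = g := hg.isSelfAdjoint
  have h1 : ∀ m ∈ S, m * g = g * m * g := by
    intro m hm
    have := hg2 (m - g * m) fun v hv => by
      have := hg1 _ (hVS m hm v hv)
      simp [this]
    rwa [sub_mul, sub_eq_zero] at this
  refine ⟨g, hgS, hg, fun m hm => ?_, ?_, ?_⟩
  · have := congrArg star (h1 (star m) (star_mem hm))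
    simp only [star_mul, hgs, star_star, ← mul_assoc] at this
    rw [h1 m hm, ← this]
  · ext ξ
    exact hg1 _ (Submodule.subset_span ⟨1, one_mem S, ξ, rfl⟩)
  · apply hg2
    intro v hv
    induction hv using Submodule.span_induction with
    | mem x hx =>
      obtain ⟨n, hn, ξ, rfl⟩ := hx
      exact congrArg (fun f : H →L[ℂ] H => f ξ) (hf n hn)
    | zero => simp
    | add x y _ _ hx hy => rw [map_add, hx, hy, add_zero]
    | smul c x _ hx => rw [map_smul, hx, smul_zero]

theorem exists_halving_unit (S : VonNeumannAlgebra H) {a : H →L[ℂ] H} (ha : a ∈ S)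
    (hsa : IsSelfAdjoint a) (hn : ‖a‖ ≤ 1) :
    ∃ u ∈ S, u ∈ unitary (H →L[ℂ] H) ∧ ∃ c ∈ S, IsSelfAdjoint c ∧ (∀ m ∈ S, m * c = c * m) ∧
      ‖(1 / 2 : ℝ) • (a + u * a * star u) - c‖ ≤ 3 / 4 := by
  obtain ⟨p, hpS, hp, hap, hqa⟩ := S.exists_proj_bound ha hsa hn
  obtain ⟨v, hvS, hqvp, hvvv, hw⟩ := S.exists_partialIsometry hpS hp
  have hpp : p * p = p := hp.isIdempotentElem
  have hps : star p = p := hp.isSelfAdjoint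
  have hvS' : star v ∈ S := star_mem hvS
  have hpv : p * v = 0 := by
    rw [← hqvp, ← mul_assoc, ← mul_assoc, mul_sub, mul_one, hpp, sub_self, zero_mul, zero_mul]
  have hvp : v * p = v := by rw [← hqvp, mul_assoc, hpp]
  have hpv' : p * star v = star v := by simpa [hps] using congrArg star hvp
  have hv'p : star v * p = 0 := by simpa [hps] using congrArg star hpv
  have hvv : v * v = 0 := by
    calc v * v = v * p * v := by rw [hvp]
      _ = 0 := by rw [mul_assoc, hpv, mul_zero]
  have hv'v' : star v * star v = 0 := by simpa using congrArg star hvv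
  have hvvv' : star v * v * star v = star v := by simpa [mul_assoc] using congrArg star hvvv
  obtain ⟨h, hh⟩ : ∃ h, h = star v * v := ⟨_, rfl⟩
  obtain ⟨k, hk⟩ : ∃ k, k = v * star v := ⟨_, rfl⟩
  rw [← hh, ← hk] at hw
  have hhS : h ∈ S := hh ▸ mul_mem hvS' hvS
  have hkS : k ∈ S := hk ▸ mul_mem hvS hvS'
  have hhs : star h = h := by simp [hh]
  have hks : star k = k := by simp [hk]
  have vh : v * h = v := by rw [hh, ← mul_assoc, hvvv]
  have kv : k * v = v := by rw [hk, hvvv]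
  have hv' : h * star v = star v := by rw [hh, hvvv']
  have v'k : star v * k = star v := by rw [hk, ← mul_assoc, hvvv']
  have hv : h * v = 0 := by rw [hh, mul_assoc, hvv, mul_zero]
  have v'h : star v * h = 0 := by rw [hh, ← mul_assoc, hv'v', zero_mul]
  have vk : v * k = 0 := by rw [hk, ← mul_assoc, hvv, zero_mul]
  have kv' : k * star v = 0 := by rw [hk, mul_assoc, hv'v', mul_zero]
  have hhh : h * h = h := by conv_lhs => rw [hh, mul_assoc, ← hh, vh, ← hh]
  have hkk : k * k = k := by conv_lhs => rw [hk, mul_assoc, ← hk, v'k, ← hk]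
  have hhk : h * k = 0 := by rw [hk, ← mul_assoc, hv, zero_mul]
  have hkh : k * h = 0 := by rw [hh, ← mul_assoc, kv', zero_mul]
  have hph : p * h = h := by rw [hh, ← mul_assoc, hpv']
  have hhp : h * p = h := by rw [hh, mul_assoc, hvp]
  have hpk : p * k = 0 := by rw [hk, ← mul_assoc, hpv, zero_mul]
  have hkp : k * p = 0 := by rw [hk, mul_assoc, hv'p, mul_zero]
  obtain ⟨e, he⟩ : ∃ e, e = p - h := ⟨_, rfl⟩
  obtain ⟨f, hf⟩ : ∃ f, f = 1 - p - k := ⟨_, rfl⟩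
  rw [← he, ← hf] at hw
  have heS : e ∈ S := he ▸ sub_mem hpS hhS
  have hfS : f ∈ S := hf ▸ sub_mem (sub_mem (one_mem S) hpS) hkS
  have heP : IsStarProjection e := by
    refine ⟨?_, ?_⟩
    · change e * e = e
      rw [he]
      simp only [mul_sub, sub_mul, hpp, hph, hhp, hhh]
      abel
    · change star e = e
      rw [he, star_sub, hps, hhs]
  have hfP : IsStarProjection f := by
    refine ⟨?_, ?_⟩
    · change f * f = f
      rw [hf]
      simp only [mul_sub, sub_mul, hpp, hpk, hkp, hkk, mul_one, one_mul]
      abel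
    · change star f = f
      rw [hf, star_sub, star_sub, hps, hks, star_one]
  obtain ⟨g, hgS, hg, hgc, hge, hfg⟩ := S.exists_central_proj heS hw
  have hgs : star g = g := hg.isSelfAdjoint
  obtain ⟨u, hu⟩ : ∃ u, u = v + star v + e + f := ⟨_, rfl⟩
  have huS : u ∈ S := hu ▸ add_mem (add_mem (add_mem hvS hvS') heS) hfS
  have hus : star u = u := by
    rw [hu]
    simp only [star_add, star_star, heP.isSelfAdjoint.star_eq, hfP.isSelfAdjoint.star_eq]
    abel
  have huu : u * u = 1 := by
    rw [hu, he, hf]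
    simp only [mul_add, add_mul, mul_sub, sub_mul, mul_one, one_mul, hpp, hph, hhp, hhh, hkk, hpk,
      hkp, hpv, hvp, hpv', hv'p, hvv, hv'v', vh, kv, hv', v'k, hv, v'h, vk, kv', hhk, hkh,
      ← hh, ← hk]
    abel
  have hupu : u * p * u = k + e := by
    rw [hu, he, hf]
    simp only [mul_add, add_mul, mul_sub, sub_mul, mul_one, one_mul, hpp, hph, hhp, hhh, hpk, hkp,
      hpv, hvp, hpv', hv'p, hvv, vh, hv', hv, vk, hhk, ← hk, zero_mul]
    abel
  have hule : u * a * u ≤ k + e := by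
    have := star_left_conjugate_le_conjugate hap u
    rwa [hus, hupu] at this
  have huge : -(1 - (k + e)) ≤ u * a * u := by
    have := star_left_conjugate_le_conjugate hqa u
    rw [hus] at this
    refine le_trans (le_of_eq ?_) this
    rw [mul_neg, neg_mul, mul_sub, sub_mul, hupu, mul_one, huu]
  have heg : e ≤ g := by
    have := star_left_conjugate_le_conjugate heP.le_one g
    rwa [hgs, hge, (hgc e heS).trans hge, mul_one, hg.isIdempotentElem.eq] at this
  have hfg' : f ≤ 1 - g := by
    have := star_left_conjugate_le_conjugate hfP.le_one (1 - g)
    rw [hg.one_sub.isSelfAdjoint.star_eq, mul_one, hg.one_sub.isIdempotentElem.eq] at this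
    rwa [mul_assoc, mul_sub f, hfg, mul_one, sub_zero, sub_mul, one_mul, ← hgc f hfS, hfg,
      sub_zero] at this
  have hkef : p + (k + e) = 1 - f + e := by rw [hf]; abel
  refine ⟨u, huS, ⟨by rw [hus, huu], by rw [hus, huu]⟩,
    (1 / 2 : ℝ) • g - algebraMap ℝ _ (1 / 4), sub_mem (S.real_smul_mem_s16 _ hgS) (S.algebraMap_mem _),
    ?_, ?_, ?_⟩
  · change star _ = _
    rw [star_sub, star_smul, hgs, star_trivial, ← algebraMap_star_comm, star_trivial]
  · intro m hm
    rw [mul_sub, sub_mul, mul_smul_comm, smul_mul_assoc, hgc m hm, Algebra.commutes]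
  rw [hus]
  have hup : a + u * a * u ≤ 1 + g := by
    calc a + u * a * u ≤ p + (k + e) := by gcongr
      _ = 1 - f + e := hkef
      _ ≤ 1 - 0 + g := by gcongr; exact hfP.nonneg
      _ = 1 + g := by rw [sub_zero]
  have hlow : g - 2 ≤ a + u * a * u := by
    calc g - 2 = -(1 - 0 + (1 - g)) := by
            rw [show (2 : H →L[ℂ] H) = 1 + 1 by norm_num]
            abel
      _ ≤ -(1 - e + f) := by gcongr; exact heP.nonneg
      _ = -(1 - p) + -(1 - (k + e)) := by rw [hf]; abel
      _ ≤ a + u * a * u := by gcongr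
  apply norm_le_of_mem_Icc (by norm_num)
  · change star _ = _
    simp only [star_sub, star_smul, hgs, star_trivial, ← algebraMap_star_comm, star_add, star_mul,
      hus, hsa.star_eq, mul_assoc]
  · have : (1 / 2 : ℝ) • (a + u * a * u) ≤ (1 / 2 : ℝ) • (1 + g) := by gcongr
    refine (sub_le_sub_right this _).trans (le_of_eq ?_)
    simp only [Algebra.algebraMap_eq_smul_one]
    module
  · have : (1 / 2 : ℝ) • (g - 2) ≤ (1 / 2 : ℝ) • (a + u * a * u) := by gcongr
    refine le_trans (le_of_eq ?_) (sub_le_sub_right this _)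
    rw [show (2 : H →L[ℂ] H) = (2 : ℝ) • 1 by rw [← Algebra.algebraMap_eq_smul_one, map_ofNat]]
    simp only [Algebra.algebraMap_eq_smul_one]
    module

theorem exists_halving (S : VonNeumannAlgebra H) {a : H →L[ℂ] H} (ha : a ∈ S)
    (hsa : IsSelfAdjoint a) {r : ℝ} (hn : ‖a‖ ≤ r) :
    ∃ u ∈ S, u ∈ unitary (H →L[ℂ] H) ∧ ∃ c ∈ S, IsSelfAdjoint c ∧ (∀ m ∈ S, m * c = c * m) ∧
      ‖(1 / 2 : ℝ) • (a + u * a * star u) - c‖ ≤ 3 / 4 * r := by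
  rcases eq_or_lt_of_le ((norm_nonneg a).trans hn) with hr | hr
  · have : a = 0 := by rw [← norm_le_zero_iff, hr]; exact hn
    refine ⟨1, one_mem S, one_mem _, 0, zero_mem S, .zero _, fun m _ => ?_, ?_⟩
    · rw [mul_zero, zero_mul]
    · rw [this, ← hr, mul_zero, mul_zero, zero_mul, add_zero, smul_zero, sub_zero, norm_zero]
  have hn' : ‖r⁻¹ • a‖ ≤ 1 := by
    rw [norm_smul, norm_inv, Real.norm_of_nonneg hr.le, inv_mul_le_iff₀ hr, mul_one]
    exact hn
  have hsa' : IsSelfAdjoint (r⁻¹ • a) := by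
    change star _ = _
    rw [star_smul, hsa.star_eq, star_trivial]
  obtain ⟨u, huS, hu, c, hcS, hcs, hc, hb⟩ := S.exists_halving_unit
    (S.real_smul_mem_s16 r⁻¹ ha) hsa' hn'
  have hrc : IsSelfAdjoint (r • c) := by
    change star _ = _
    rw [star_smul, hcs.star_eq, star_trivial]
  refine ⟨u, huS, hu, r • c, S.real_smul_mem_s16 r hcS, hrc, fun m hm => ?_, ?_⟩
  · rw [mul_smul_comm, smul_mul_assoc, hc m hm]
  · have e : (1 / 2 : ℝ) • (a + u * a * star u) - r • c =
        r • ((1 / 2 : ℝ) • (r⁻¹ • a + u * (r⁻¹ • a) * star u) - c) := by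
      rw [mul_smul_comm, smul_mul_assoc, ← smul_add, smul_comm (1 / 2 : ℝ), smul_sub, smul_smul,
        mul_inv_cancel₀ hr.ne', one_smul]
    rw [e, norm_smul, Real.norm_of_nonneg hr.le, mul_comm]
    exact mul_le_mul_of_nonneg_right hb hr.le

/-- The Dixmier averaging theorem: the closed convex hull of the unitary orbit of a self-adjoint
element meets the centre. -/
theorem exists_central_average (S : VonNeumannAlgebra H) {a : H →L[ℂ] H} (ha : a ∈ S)
    (hsa : IsSelfAdjoint a) :
    ∃ c : H →L[ℂ] H, (∀ m ∈ S, m * c = c * m) ∧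
      ∀ P : Set (H →L[ℂ] H), IsClosed P → Convex ℝ P →
        (∀ u ∈ S, u ∈ unitary (H →L[ℂ] H) → u * a * star u ∈ P) → c ∈ P := by
  let C : Set (H →L[ℂ] H) :=
    convexHull ℝ {x | ∃ u ∈ S, u ∈ unitary (H →L[ℂ] H) ∧ x = u * a * star u}
  have hCS : ∀ x ∈ C, x ∈ S := by
    intro x hx
    refine convexHull_min (t := (S : Set (H →L[ℂ] H))) ?_ ?_ hx
    · rintro _ ⟨u, hu, -, rfl⟩
      exact mul_mem (mul_mem hu ha) (star_mem hu)
    · intro x hx y hy s t _ _ _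
      exact add_mem (S.real_smul_mem_s16 _ hx) (S.real_smul_mem_s16 _ hy)
  have hCsa : ∀ x ∈ C, IsSelfAdjoint x := by
    intro x hx
    refine convexHull_min (t := {x | IsSelfAdjoint x}) ?_ ?_ hx
    · rintro _ ⟨u, -, -, rfl⟩
      exact hsa.conjugate u
    · intro x hx y hy s t _ _ _
      change star _ = _
      have hx' : star x = x := hx
      have hy' : star y = y := hy
      rw [star_add, star_smul, star_smul, star_trivial s, star_trivial t, hx', hy']
  have hCu : ∀ u ∈ S, u ∈ unitary (H →L[ℂ] H) → ∀ x ∈ C, u * x * star u ∈ C := by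
    intro u hu hu' x hx
    refine convexHull_min (t := {x | u * x * star u ∈ C}) ?_ ?_ hx
    · rintro _ ⟨v, hv, hv', rfl⟩
      refine subset_convexHull ℝ _ ⟨u * v, mul_mem hu hv, mul_mem hu' hv', ?_⟩
      simp only [star_mul, mul_assoc]
    · intro x hx y hy s t hs ht hst
      have := convex_convexHull ℝ _ hx hy hs ht hst
      rw [Set.mem_ofPred_eq, mul_add, add_mul]
      simpa only [mul_smul_comm, smul_mul_assoc] using this
  obtain ⟨r, hr⟩ : ∃ r, r = ‖a‖ := ⟨_, rfl⟩
  let Inv : ℕ → (H →L[ℂ] H) × (H →L[ℂ] H) → Prop := fun n p =>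
    p.1 ∈ C ∧ p.2 ∈ S ∧ IsSelfAdjoint p.2 ∧ (∀ m ∈ S, m * p.2 = p.2 * m) ∧
      ‖p.1 - p.2‖ ≤ (3 / 4) ^ n * r
  have step : ∀ n p, Inv n p → ∃ p', Inv (n + 1) p' ∧ ‖p.2 - p'.2‖ ≤ 2 * r * (3 / 4) ^ n := by
    rintro n ⟨x, d⟩ ⟨hx, hdS, hds, hd, hb⟩
    obtain ⟨u, huS, hu, c, hcS, hcs, hc, hb'⟩ := S.exists_halving
      (sub_mem (hCS x hx) hdS) ((hCsa x hx).sub hds) hb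
    have hdu : u * d * star u = d := by
      rw [hd u huS, mul_assoc, Unitary.mul_star_self_of_mem hu, mul_one]
    have e : (1 / 2 : ℝ) • (x - d + u * (x - d) * star u) - c =
        (1 / 2 : ℝ) • (x + u * x * star u) - (d + c) := by
      rw [mul_sub, sub_mul, hdu]
      module
    rw [e] at hb'
    refine ⟨((1 / 2 : ℝ) • (x + u * x * star u), d + c), ⟨?_, add_mem hdS hcS, hds.add hcs,
      fun m hm => ?_, ?_⟩, ?_⟩
    · rw [smul_add]
      exact convex_convexHull ℝ _ hx (hCu u huS hu x hx) (by norm_num) (by norm_num) (by norm_num)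
    · rw [mul_add, add_mul, hd m hm, hc m hm]
    · rw [pow_succ]
      exact hb'.trans (le_of_eq (by ring))
    · have hb2 : ‖u * (x - d) * star u‖ ≤ (3 / 4) ^ n * r := by
        have h1 := CStarRing.norm_coe_unitary_mul ⟨u, hu⟩ ((x - d) * star u)
        have h2 := CStarRing.norm_mul_coe_unitary (x - d) (star (⟨u, hu⟩ : unitary (H →L[ℂ] H)))
        simp only [Unitary.coe_star] at h1 h2
        rw [mul_assoc, h1, h2]
        exact hb
      have e2 : d - (d + c) = ((1 / 2 : ℝ) • (x + u * x * star u) - (d + c)) -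
          ((1 / 2 : ℝ) • (x - d) + (1 / 2 : ℝ) • (u * (x - d) * star u)) := by
        rw [mul_sub, sub_mul, hdu]
        module
      change ‖d - (d + c)‖ ≤ _
      rw [e2]
      refine (norm_sub_le _ _).trans ?_
      have h3 := norm_add_le ((1 / 2 : ℝ) • (x - d)) ((1 / 2 : ℝ) • (u * (x - d) * star u))
      rw [norm_smul, norm_smul, Real.norm_of_nonneg (by norm_num : (0 : ℝ) ≤ 1 / 2)] at h3
      have hb1 : ‖x - d‖ ≤ (3 / 4) ^ n * r := hb
      have h0 : 0 ≤ (3 / 4 : ℝ) ^ n * r := (norm_nonneg _).trans hb1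
      linarith
  have start : Inv 0 (a, 0) :=
    ⟨subset_convexHull ℝ _ ⟨1, one_mem S, one_mem _, by simp⟩, zero_mem S, .zero _,
      fun m _ => by rw [mul_zero, zero_mul], by simp [hr]⟩
  choose nxt hnxt1 hnxt2 using step
  let f : ∀ n, {p // Inv n p} := fun n =>
    Nat.rec ⟨(a, 0), start⟩ (fun n p => ⟨nxt n p.1 p.2, hnxt1 n p.1 p.2⟩) n
  have hf : ∀ n, ‖(f n).1.2 - (f (n + 1)).1.2‖ ≤ 2 * r * (3 / 4) ^ n :=
    fun n => hnxt2 n (f n).1 (f n).2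
  have hcau : CauchySeq fun n => (f n).1.2 :=
    cauchySeq_of_le_geometric (3 / 4) (2 * r) (by norm_num) fun n => by
      rw [dist_eq_norm]
      exact hf n
  obtain ⟨c, hc⟩ := cauchySeq_tendsto_of_complete hcau
  have hx : Tendsto (fun n => (f n).1.1) atTop (𝓝 c) := by
    have h0 : Tendsto (fun n => (f n).1.1 - (f n).1.2) atTop (𝓝 0) := by
      refine squeeze_zero_norm (fun n => (f n).2.2.2.2.2) ?_
      simpa using (tendsto_pow_atTop_nhds_zero_of_lt_one (by norm_num : (0 : ℝ) ≤ 3 / 4)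
        (by norm_num)).mul_const r
    simpa using h0.add hc
  refine ⟨c, fun m hm => ?_, fun P hP1 hP2 hP3 => ?_⟩
  · refine tendsto_nhds_unique (hc.const_mul m) ?_
    refine (hc.mul_const m).congr fun n => ?_
    exact ((f n).2.2.2.2.1 m hm).symm
  · refine hP1.mem_of_tendsto hx (.of_forall fun n => ?_)
    refine convexHull_min ?_ hP2 (f n).2.1
    rintro _ ⟨u, hu, hu', rfl⟩
    exact hP3 u hu hu'

/-- A faithful positive tracial functional on `M`; no continuity is required. -/
structure IsFaithfulTrace (M : VonNeumannAlgebra H) (τ : (H →L[ℂ] H) →ₗ[ℂ] ℂ) : Prop where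
  pos : ∀ x ∈ M, 0 ≤ τ (star x * x)
  faithful : ∀ x ∈ M, τ (star x * x) = 0 → x = 0
  comm : ∀ x ∈ M, ∀ y ∈ M, τ (x * y) = τ (y * x)

variable {M : VonNeumannAlgebra H} {τ : (H →L[ℂ] H) →ₗ[ℂ] ℂ}

namespace IsFaithfulTrace

theorem nonneg (hτ : M.IsFaithfulTrace τ) {x : H →L[ℂ] H} (hx : x ∈ M) (h0 : 0 ≤ x) :
    0 ≤ τ x := by
  have h1 := hτ.pos _ (M.sqrt_mem hx h0)
  rwa [(CFC.sqrt_nonneg x).isSelfAdjoint.star_eq, CFC.sqrt_mul_sqrt_self x h0] at h1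

theorem mono (hτ : M.IsFaithfulTrace τ) {x y : H →L[ℂ] H} (hx : x ∈ M) (hy : y ∈ M)
    (hxy : x ≤ y) : τ x ≤ τ y := by
  have := hτ.nonneg (sub_mem hy hx) (sub_nonneg.2 hxy)
  rwa [map_sub, sub_nonneg] at this

theorem re_mono (hτ : M.IsFaithfulTrace τ) {x y : H →L[ℂ] H} (hx : x ∈ M) (hy : y ∈ M)
    (hxy : x ≤ y) : (τ x).re ≤ (τ y).re :=
  (Complex.le_def.1 (hτ.mono hx hy hxy)).1

theorem im_eq_zero (hτ : M.IsFaithfulTrace τ) {x : H →L[ℂ] H} (hx : x ∈ M)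
    (hsa : IsSelfAdjoint x) : (τ x).im = 0 := by
  have h1 := hτ.nonneg (M.posPart_mem hx hsa) (CFC.posPart_nonneg x)
  have h2 := hτ.nonneg (x := x⁺ - x) (sub_mem (M.posPart_mem hx hsa) hx) (by
    rw [sub_nonneg]
    exact CFC.le_posPart)
  have e : x = x⁺ - (x⁺ - x) := by abel
  rw [e, map_sub, Complex.sub_im, ← (Complex.nonneg_iff.1 h1).2, ← (Complex.nonneg_iff.1 h2).2,
    sub_zero]

theorem exists_re_im {x : H →L[ℂ] H} (hx : x ∈ M) :
    ∃ a ∈ M, ∃ b ∈ M, IsSelfAdjoint a ∧ IsSelfAdjoint b ∧ x = a + Complex.I • b ∧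
      ‖a‖ ≤ ‖x‖ ∧ ‖b‖ ≤ ‖x‖ := by
  refine ⟨realPart x, ?_, imaginaryPart x, ?_, (realPart x).2, (imaginaryPart x).2,
    (realPart_add_I_smul_imaginaryPart x).symm, realPart.norm_le x, imaginaryPart.norm_le x⟩
  · rw [realPart_apply_coe]
    exact M.real_smul_mem_s16 _ (add_mem hx (star_mem hx))
  · rw [imaginaryPart_apply_coe]
    exact M.smul_mem _ (M.real_smul_mem_s16 _ (sub_mem hx (star_mem hx)))

theorem map_star (hτ : M.IsFaithfulTrace τ) {x : H →L[ℂ] H} (hx : x ∈ M) :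
    τ (star x) = star (τ x) := by
  obtain ⟨a, ha, b, hb, has, hbs, rfl, -, -⟩ := exists_re_im hx
  have h1 : star (τ a) = τ a := Complex.conj_eq_iff_im.2 (hτ.im_eq_zero ha has)
  have h2 : star (τ b) = τ b := Complex.conj_eq_iff_im.2 (hτ.im_eq_zero hb hbs)
  rw [star_add, star_smul, has.star_eq, hbs.star_eq, map_add, map_add, star_add, map_smul, map_smul,
    smul_eq_mul, smul_eq_mul, star_mul', h1, h2]

theorem norm_le (hτ : M.IsFaithfulTrace τ) {x : H →L[ℂ] H} (hx : x ∈ M) :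
    ‖τ x‖ ≤ 2 * (τ 1).re * ‖x‖ := by
  have key : ∀ a ∈ M, IsSelfAdjoint a → ‖τ a‖ ≤ (τ 1).re * ‖a‖ := by
    intro a ha hsa
    have h1 := hτ.re_mono ha (M.algebraMap_mem ‖a‖) hsa.le_algebraMap_norm_self
    have h2 := hτ.re_mono (neg_mem (M.algebraMap_mem ‖a‖)) ha hsa.neg_algebraMap_norm_le_self
    have e : τ (algebraMap ℝ (H →L[ℂ] H) ‖a‖) = (‖a‖ : ℂ) * τ 1 := by
      rw [Algebra.algebraMap_eq_smul_one, ← Complex.coe_smul, map_smul, smul_eq_mul]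
    rw [map_neg, Complex.neg_re] at h2
    rw [e, Complex.re_ofReal_mul] at h1 h2
    have e2 : τ a = ((τ a).re : ℂ) := Complex.ext rfl (by simp [hτ.im_eq_zero ha hsa])
    rw [e2, Complex.norm_real, Real.norm_eq_abs, abs_le]
    constructor <;> linarith
  have h1 : 0 ≤ (τ 1).re := by
    have := hτ.nonneg (one_mem M) zero_le_one
    exact (Complex.nonneg_iff.1 this).1
  obtain ⟨a, ha, b, hb, has, hbs, e, hna, hnb⟩ := exists_re_im hx
  calc ‖τ x‖ = ‖τ a + Complex.I * τ b‖ := by rw [e, map_add, map_smul, smul_eq_mul]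
    _ ≤ ‖τ a‖ + ‖τ b‖ := by
      refine (norm_add_le _ _).trans ?_
      rw [norm_mul, Complex.norm_I, one_mul]
    _ ≤ (τ 1).re * ‖a‖ + (τ 1).re * ‖b‖ := add_le_add (key a ha has) (key b hb hbs)
    _ ≤ (τ 1).re * ‖x‖ + (τ 1).re * ‖x‖ := by gcongr
    _ = 2 * (τ 1).re * ‖x‖ := by ring

theorem eq_zero_of_mul_star (hτ : M.IsFaithfulTrace τ) {x : H →L[ℂ] H} (hx : x ∈ M)
    (h : τ (x * star x) = 0) : x = 0 :=
  hτ.faithful x hx (by rw [hτ.comm _ (star_mem hx) _ hx, h])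

end IsFaithfulTrace

/-- The elements `b` of `M` for which `x ↦ τ (b * x)` is weak operator continuous on bounded
subsets of `M`. -/
def normalPart (M : VonNeumannAlgebra H) (τ : (H →L[ℂ] H) →ₗ[ℂ] ℂ) : Set (H →L[ℂ] H) :=
  {b | b ∈ M ∧ ∀ r : ℝ, ContinuousOn (fun A : H →WOT[ℂ] H => τ (b * A.toCLM))
    {A | A.toCLM ∈ M ∧ ‖A.toCLM‖ ≤ r}}

namespace normalPart

theorem add {b c : H →L[ℂ] H} (hb : b ∈ M.normalPart τ) (hc : c ∈ M.normalPart τ) :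
    b + c ∈ M.normalPart τ := by
  refine ⟨add_mem hb.1 hc.1, fun r => ?_⟩
  simp only [add_mul, map_add]
  exact (hb.2 r).add (hc.2 r)

theorem smul {b : H →L[ℂ] H} (s : ℂ) (hb : b ∈ M.normalPart τ) : s • b ∈ M.normalPart τ := by
  refine ⟨M.smul_mem s hb.1, fun r => ?_⟩
  simp only [smul_mul_assoc, map_smul]
  exact (hb.2 r).const_smul s

theorem real_smul {b : H →L[ℂ] H} (s : ℝ) (hb : b ∈ M.normalPart τ) :
    s • b ∈ M.normalPart τ := by
  rw [← Complex.coe_smul]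
  exact smul _ hb

theorem mul_right {b m : H →L[ℂ] H} (hb : b ∈ M.normalPart τ) (hm : m ∈ M) :
    b * m ∈ M.normalPart τ := by
  refine ⟨mul_mem hb.1 hm, fun r => ?_⟩
  have := (hb.2 (‖m‖ * r)).comp
    (continuous_const_mul (.ofCLM m : H →WOT[ℂ] H)).continuousOn
    (s := {A | A.toCLM ∈ M ∧ ‖A.toCLM‖ ≤ r}) (fun A hA => ⟨mul_mem hm hA.1, by
      refine (norm_mul_le m A.toCLM).trans ?_
      have := hA.2
      gcongr⟩)
  refine this.congr fun A _ => ?_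
  simp [mul_assoc]

theorem mul_left (hτ : M.IsFaithfulTrace τ) {b m : H →L[ℂ] H} (hb : b ∈ M.normalPart τ)
    (hm : m ∈ M) : m * b ∈ M.normalPart τ := by
  refine ⟨mul_mem hm hb.1, fun r => ?_⟩
  have := (hb.2 (r * ‖m‖)).comp
    (continuous_mul_const (.ofCLM m : H →WOT[ℂ] H)).continuousOn
    (s := {A | A.toCLM ∈ M ∧ ‖A.toCLM‖ ≤ r}) (fun A hA => ⟨mul_mem hA.1 hm, by
      refine (norm_mul_le A.toCLM m).trans ?_
      have := hA.2
      gcongr⟩)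
  refine this.congr fun A hA => ?_
  have := hτ.comm m hm (b * A.toCLM) (mul_mem hb.1 hA.1)
  simpa [mul_assoc] using this

theorem isClosed (hτ : M.IsFaithfulTrace τ) : IsClosed (M.normalPart τ) := by
  rw [← isSeqClosed_iff_isClosed]
  intro b c hb hc
  have hcM : c ∈ M := (isClosed_coe M).mem_of_tendsto hc (.of_forall fun n => (hb n).1)
  refine ⟨hcM, fun r => ?_⟩
  refine TendstoUniformlyOn.continuousOn (p := atTop)
    (F := fun n (A : H →WOT[ℂ] H) => τ (b n * A.toCLM)) ?_
    (Eventually.frequently (.of_forall fun n => (hb n).2 r))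
  rw [Metric.tendstoUniformlyOn_iff]
  intro ε hε
  have h0 : Tendsto (fun n => 2 * (τ 1).re * (‖c - b n‖ * r)) atTop (𝓝 0) := by
    have : Tendsto (fun n => ‖c - b n‖) atTop (𝓝 0) := by
      simpa using (tendsto_const_nhds (x := c)).sub hc |>.norm
    simpa using (this.mul_const r).const_mul (2 * (τ 1).re)
  have h1 : 0 ≤ (τ 1).re := (Complex.nonneg_iff.1 (hτ.nonneg (one_mem M) zero_le_one)).1
  filter_upwards [h0.eventually_lt_const hε] with n hn A hA
  refine lt_of_le_of_lt ?_ hn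
  rw [dist_eq_norm, ← map_sub, ← sub_mul]
  refine (hτ.norm_le (mul_mem (sub_mem hcM (hb n).1) hA.1)).trans ?_
  have h2 := norm_mul_le (c - b n) A.toCLM
  have h3 := hA.2
  gcongr
  exact h2.trans (by gcongr)

theorem convex : Convex ℝ (M.normalPart τ) :=
  fun _ hx _ hy s t _ _ _ => add (real_smul s hx) (real_smul t hy)

end normalPart

theorem IsFaithfulTrace.norm_sq_le (hτ : M.IsFaithfulTrace τ) {y z : H →L[ℂ] H} (hy : y ∈ M)
    (hz : z ∈ M) {C : ℝ} (hC : 0 < C) (hyC : (τ (star y * y)).re ≤ C) :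
    ‖τ (star y * z)‖ ^ 2 ≤ C * (τ (star z * z)).re := by
  set a := τ (star y * z) with ha
  have hconj : τ (star z * y) = star a := by
    rw [ha, ← hτ.map_star (mul_mem (star_mem hy) hz), star_mul, star_star]
  set l : ℂ := a * (C⁻¹ : ℝ) with hl
  have h1 := (Complex.nonneg_iff.1 (hτ.pos (z - l • y) (sub_mem hz (M.smul_mem l hy)))).1
  have e : τ (star (z - l • y) * (z - l • y)) =
      τ (star z * z) - l * star a - star l * a + star l * l * τ (star y * y) := by
    simp only [star_sub, star_smul, mul_sub, sub_mul, smul_mul_assoc, mul_smul_comm, map_sub,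
      map_smul, smul_eq_mul, hconj, ← ha]
    ring
  have h2 : l * star a = ((C⁻¹ * ‖a‖ ^ 2 : ℝ) : ℂ) := by
    rw [hl, mul_right_comm]
    rw [show a * star a = ((‖a‖ ^ 2 : ℝ) : ℂ) by
      rw [Complex.star_def, Complex.mul_conj, Complex.normSq_eq_norm_sq]]
    push_cast
    ring
  have h3 : star l * a = ((C⁻¹ * ‖a‖ ^ 2 : ℝ) : ℂ) := by
    have := congrArg star h2
    rw [star_mul, star_star, mul_comm] at this
    rw [this, Complex.star_def, Complex.conj_ofReal]
  have h4 : star l * l = ((C⁻¹ * (C⁻¹ * ‖a‖ ^ 2) : ℝ) : ℂ) := by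
    rw [Complex.ofReal_mul, ← h3, hl]
    ring
  rw [e, h2, h3, h4, Complex.add_re, Complex.sub_re, Complex.sub_re, Complex.re_ofReal_mul,
    Complex.ofReal_re] at h1
  set n := ‖a‖ ^ 2
  have hn : 0 ≤ n := by positivity
  have h5 : C⁻¹ * (C⁻¹ * n) * (τ (star y * y)).re ≤ C⁻¹ * n := by
    calc C⁻¹ * (C⁻¹ * n) * (τ (star y * y)).re ≤ C⁻¹ * (C⁻¹ * n) * C := by gcongr
      _ = C⁻¹ * n := by field_simp
  have h6 : C⁻¹ * n ≤ (τ (star z * z)).re := by linarith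
  rwa [inv_mul_le_iff₀ hC] at h6

/-- A positive element whose density is dominated by a vector functional lies in the normal
part. -/
theorem mem_normalPart_of_le (hτ : M.IsFaithfulTrace τ) {b : H →L[ℂ] H} (hb : b ∈ M)
    (hb0 : 0 ≤ b) (ζ : H)
    (hle : ∀ x ∈ M, 0 ≤ x → (τ (b * x)).re ≤ (⟪ζ, x ζ⟫_ℂ).re) : b ∈ M.normalPart τ := by
  obtain ⟨s, hs⟩ : ∃ s, s = CFC.sqrt b := ⟨_, rfl⟩
  have hsM : s ∈ M := hs ▸ M.sqrt_mem hb hb0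
  have hss : star s = s := by rw [hs]; exact (CFC.sqrt_nonneg b).isSelfAdjoint
  have hsb : s * s = b := by rw [hs]; exact CFC.sqrt_mul_sqrt_self b hb0
  obtain ⟨C, hC, hbC⟩ : ∃ C : ℝ, 0 < C ∧ (τ b).re ≤ C :=
    ⟨max 1 (τ b).re, lt_max_of_lt_left one_pos, le_max_right _ _⟩
  have hbound : ∀ x ∈ M, ‖τ (b * x)‖ ≤ Real.sqrt C * ‖x ζ‖ := by
    intro x hx
    have h1 := hτ.norm_sq_le hsM (mul_mem hx hsM) hC (by rwa [hss, hsb])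
    have e1 : τ (star s * (x * s)) = τ (b * x) := by
      rw [hss, hτ.comm s hsM _ (mul_mem hx hsM), mul_assoc, hsb, hτ.comm x hx b hb]
    have e2 : τ (star (x * s) * (x * s)) = τ (b * (star x * x)) := by
      rw [star_mul, hss, mul_assoc, hτ.comm s hsM _ (mul_mem (star_mem hx) (mul_mem hx hsM)),
        mul_assoc, mul_assoc, hsb, ← mul_assoc,
        hτ.comm _ (mul_mem (star_mem hx) hx) b hb]
    have h2 := hle (star x * x) (mul_mem (star_mem hx) hx) (star_mul_self_nonneg x)
    have e3 : (⟪ζ, (star x * x) ζ⟫_ℂ).re = ‖x ζ‖ ^ 2 := by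
      change (⟪ζ, star x (x ζ)⟫_ℂ).re = _
      rw [ContinuousLinearMap.star_eq_adjoint, ContinuousLinearMap.adjoint_inner_right,
        inner_self_eq_norm_sq_to_K]
      norm_cast
    rw [e1, e2] at h1
    rw [e3] at h2
    refine le_of_sq_le_sq ?_ (by positivity)
    rw [mul_pow, Real.sq_sqrt hC.le]
    exact h1.trans (by gcongr)
  let T : M.toStarSubalgebra.toSubalgebra.toSubmodule →ₗ[ℂ] H :=
    { toFun := fun x => (x : H →L[ℂ] H) ζ
      map_add' := fun x y => rfl
      map_smul' := fun c x => rfl }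
  obtain ⟨g, hg⟩ := T.rangeRestrict.exists_rightInverse_of_surjective
    (LinearMap.range_rangeRestrict T)
  have hTg : ∀ y, T (g y) = y := fun y =>
    congrArg Subtype.val (LinearMap.congr_fun hg y)
  let f₀ : LinearMap.range T →ₗ[ℂ] ℂ :=
    { toFun := fun y => τ (b * (g y : H →L[ℂ] H))
      map_add' := fun x y => by simp [mul_add]
      map_smul' := fun c x => by simp }
  obtain ⟨f, hf, -⟩ := exists_extension_norm_eq (𝕜 := ℂ) _
    (f₀.mkContinuous (Real.sqrt C) fun y => by
      refine (hbound _ (g y).2).trans (le_of_eq ?_)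
      exact congrArg (Real.sqrt C * ‖·‖) (hTg y))
  have hfx : ∀ x ∈ M, f (x ζ) = τ (b * x) := by
    intro x hx
    let y : LinearMap.range T := ⟨T ⟨x, hx⟩, ⟨⟨x, hx⟩, rfl⟩⟩
    have h1 : f (x ζ) = τ (b * (g y : H →L[ℂ] H)) := hf y
    have h2 := hbound (g y - x) (sub_mem (g y).2 hx)
    have h3 : ((g y : H →L[ℂ] H) - x) ζ = 0 := sub_eq_zero.2 (hTg y)
    rw [h3, norm_zero, mul_zero, norm_le_zero_iff, mul_sub, map_sub, sub_eq_zero] at h2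
    rw [h1, h2]
  refine ⟨hb, fun r => ?_⟩
  have hcont : Continuous fun A : H →WOT[ℂ] H => f (A ζ) :=
    ContinuousLinearMapWOT.continuous_dual_apply ζ f
  exact hcont.continuousOn.congr fun A hA => (hfx _ hA.1).symm

/-- The normal part is order dense. -/
theorem exists_mem_normalPart_le (hτ : M.IsFaithfulTrace τ) {k : H →L[ℂ] H} (hk : k ∈ M)
    (hk0 : 0 ≤ k) (hk1 : k ≠ 0) : ∃ b ∈ M.normalPart τ, 0 ≤ b ∧ b ≤ k ∧ b ≠ 0 := by
  obtain ⟨η, hη⟩ : ∃ η : H, (τ k).re < (⟪η, k η⟫_ℂ).re := by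
    obtain ⟨ξ, hξ⟩ : ∃ ξ, ⟪ξ, k ξ⟫_ℂ ≠ 0 := by
      by_contra! h
      apply hk1
      have := (inner_map_self_eq_zero (k : H →ₗ[ℂ] H)).1 fun x =>
        inner_eq_zero_symm.1 (h x)
      ext x
      exact LinearMap.congr_fun this x
    have hpos : 0 < (⟪ξ, k ξ⟫_ℂ).re := by
      have h1 := ((ContinuousLinearMap.nonneg_iff_isPositive k).1 hk0).inner_nonneg_right ξ
      have h2 := lt_of_le_of_ne h1 hξ.symm
      exact (Complex.pos_iff.1 h2).1
    obtain ⟨n, hn⟩ := exists_nat_gt ((τ k).re / (⟪ξ, k ξ⟫_ℂ).re)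
    refine ⟨((n + 1 : ℝ) : ℂ) • ξ, ?_⟩
    rw [map_smul, inner_smul_left, inner_smul_right, Complex.conj_ofReal, Complex.re_ofReal_mul,
      Complex.re_ofReal_mul]
    rw [div_lt_iff₀ hpos] at hn
    have : (0 : ℝ) ≤ n := Nat.cast_nonneg n
    nlinarith [mul_nonneg this hpos.le, mul_nonneg this (mul_nonneg this hpos.le)]
  obtain ⟨ω, hω⟩ : ∃ ω : (H →L[ℂ] H) → ℝ, ω = fun x => (⟪η, x η⟫_ℂ).re := ⟨_, rfl⟩
  have hωadd : ∀ x y, ω (x + y) = ω x + ω y := fun x y => by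
    simp [hω]
  let Z : Set (H →L[ℂ] H) := {h | h ∈ M ∧ 0 ≤ h ∧ h ≤ k ∧ ω h ≤ (τ h).re}
  have hZ0 : 0 ∈ Z := ⟨zero_mem M, le_rfl, hk0, by simp [hω]⟩
  obtain ⟨h, -, ⟨⟨hhM, hh0, hhk, hhω⟩, hmax⟩⟩ := zorn_le_nonempty₀ Z (by
    intro c hc hchain y hy
    have hbdd : BddAbove ((fun h => (τ h).re) '' c) := by
      refine ⟨(τ k).re, ?_⟩
      rintro _ ⟨h, hh, rfl⟩
      exact hτ.re_mono (hc hh).1 hk (hc hh).2.2.1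
    let F : c → Set (H →WOT[ℂ] H) := fun i =>
      ({A | A.toCLM ∈ M} ∩ {A | 0 ≤ (A - .ofCLM i.1).toCLM} ∩ {A | 0 ≤ (.ofCLM k - A).toCLM} ∩
        {A | ω A.toCLM ≤ sSup ((fun h => (τ h).re) '' c)}) ∩ {A | ‖A.toCLM‖ ≤ ‖k‖}
    have hFc : ∀ i, IsCompact (F i) := fun i => by
      refine (isCompact_wot_ball_s16 ‖k‖).inter_left ?_
      refine (((isClosed_wot_mem M).inter ?_).inter ?_).inter ?_
      · exact isClosed_wot_nonneg.preimage (continuous_id.sub continuous_const)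
      · exact isClosed_wot_nonneg.preimage (continuous_const.sub continuous_id)
      · refine isClosed_le ?_ continuous_const
        rw [hω]
        exact Complex.continuous_re.comp
          (ContinuousLinearMapWOT.continuous_inner_apply continuous_id η η)
    have hFn : ∀ i, (F i).Nonempty := fun i => by
      obtain ⟨h1, h2, h3, h4⟩ := hc i.2
      refine ⟨.ofCLM i.1, ⟨⟨⟨h1, ?_⟩, ?_⟩, ?_⟩, ?_⟩
      · exact (sub_self (i : H →L[ℂ] H)).symm.le
      · exact sub_nonneg.2 h3
      · exact h4.trans (le_csSup hbdd ⟨i.1, i.2, rfl⟩)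
      · exact CStarAlgebra.norm_le_norm_of_nonneg_of_le h2 h3
    have hmono : ∀ i j : c, i.1 ≤ j.1 → F j ⊆ F i := by
      rintro i j hij A ⟨⟨⟨⟨h1, h2⟩, h3⟩, h4⟩, h5⟩
      refine ⟨⟨⟨⟨h1, ?_⟩, h3⟩, h4⟩, h5⟩
      exact sub_nonneg.2 (hij.trans (sub_nonneg.1 h2))
    have hdir : Directed (· ⊇ ·) F := by
      intro i j
      rcases hchain.total i.2 j.2 with hij | hij
      · exact ⟨j, hmono i j hij, subset_rfl⟩
      · exact ⟨i, subset_rfl, hmono j i hij⟩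
    have : Nonempty c := ⟨⟨y, hy⟩⟩
    obtain ⟨A, hA⟩ := IsCompact.nonempty_iInter_of_directed_nonempty_isCompact_isClosed F hdir hFn
      hFc fun i => (hFc i).isClosed
    rw [Set.mem_iInter] at hA
    have hub : ∀ z ∈ c, z ≤ A.toCLM := fun z hz => sub_nonneg.1 (hA ⟨z, hz⟩).1.1.1.2
    obtain ⟨⟨⟨⟨h1, -⟩, h3⟩, h4⟩, h5⟩ := hA ⟨y, hy⟩
    refine ⟨A.toCLM, ⟨h1, (hc hy).2.1.trans (hub y hy), sub_nonneg.1 h3, ?_⟩, hub⟩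
    refine le_trans h4 (csSup_le ⟨_, y, hy, rfl⟩ ?_)
    rintro _ ⟨h, hh, rfl⟩
    exact hτ.re_mono (hc hh).1 h1 (hub h hh)) 0 hZ0
  have hbM : k - h ∈ M := sub_mem hk hhM
  have hb0 : 0 ≤ k - h := sub_nonneg.2 hhk
  have hdom : ∀ x ∈ M, 0 ≤ x → x ≤ k - h → (τ x).re ≤ ω x := by
    intro x hx hx0 hxk
    by_contra! hlt
    have hz : h + x ∈ Z := by
      refine ⟨add_mem hhM hx, add_nonneg hh0 hx0, ?_, ?_⟩
      · rw [add_comm]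
        exact le_sub_iff_add_le.1 hxk
      · rw [hωadd, map_add, Complex.add_re]
        exact add_le_add hhω hlt.le
    have h1 : h + x ≤ h := hmax hz (le_add_of_nonneg_right hx0)
    have h2 : x = 0 := le_antisymm (by simpa using h1) hx0
    simp [h2, hω] at hlt
  refine ⟨k - h, ?_, hb0, sub_le_self _ hh0, fun h0 => ?_⟩
  · obtain ⟨s, hs⟩ : ∃ s, s = CFC.sqrt (k - h) := ⟨_, rfl⟩
    have hsM : s ∈ M := hs ▸ M.sqrt_mem hbM hb0
    have hss : star s = s := by rw [hs]; exact (CFC.sqrt_nonneg _).isSelfAdjoint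
    have hsb : s * s = k - h := by rw [hs]; exact CFC.sqrt_mul_sqrt_self _ hb0
    refine mem_normalPart_of_le hτ hbM hb0 (s η) fun x hx hx0 => ?_
    have e1 : τ ((k - h) * x) = τ (s * x * s) := by
      rw [← hsb, mul_assoc, hτ.comm s hsM _ (mul_mem hsM hx)]
    have e2 : (⟪s η, x (s η)⟫_ℂ).re = ω (s * x * s) := by
      rw [hω]
      change _ = (⟪η, s (x (s η))⟫_ℂ).re
      have := ContinuousLinearMap.adjoint_inner_left s (x (s η)) η
      rw [← ContinuousLinearMap.star_eq_adjoint, hss] at this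
      rw [this]
    rw [e1, e2]
    rcases eq_or_ne x 0 with rfl | hxne
    · simp [hω]
    have hn : 0 < ‖x‖ := norm_pos_iff.2 hxne
    have hx1 : ‖x‖⁻¹ • x ≤ 1 := by
      have h1 := hx0.isSelfAdjoint.le_algebraMap_norm_self
      calc ‖x‖⁻¹ • x ≤ ‖x‖⁻¹ • algebraMap ℝ (H →L[ℂ] H) ‖x‖ := by gcongr
        _ = 1 := by rw [Algebra.algebraMap_eq_smul_one, smul_smul, inv_mul_cancel₀ hn.ne', one_smul]
    have hx2 : 0 ≤ ‖x‖⁻¹ • x := smul_nonneg (inv_nonneg.2 hn.le) hx0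
    have h1 := star_left_conjugate_le_conjugate hx1 s
    have h2 := star_left_conjugate_nonneg hx2 s
    rw [hss, mul_one, hsb] at h1
    rw [hss] at h2
    have h3 := hdom _ (mul_mem (mul_mem hsM (M.real_smul_mem_s16 _ hx)) hsM) h2 h1
    rw [mul_smul_comm, smul_mul_assoc] at h3
    have e3 : τ (‖x‖⁻¹ • (s * x * s)) = ((‖x‖⁻¹ : ℝ) : ℂ) * τ (s * x * s) := by
      rw [← Complex.coe_smul, map_smul, smul_eq_mul]
    have e4 : ω (‖x‖⁻¹ • (s * x * s)) = ‖x‖⁻¹ * ω (s * x * s) := by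
      simp only [hω]
      rw [← Complex.coe_smul, smul_apply, inner_smul_right,
        Complex.re_ofReal_mul]
    rw [e3, e4, Complex.re_ofReal_mul] at h3
    exact le_of_mul_le_mul_left h3 (inv_pos.2 hn)
  · rw [sub_eq_zero] at h0
    rw [← h0] at hhω
    rw [hω] at hhω
    exact absurd hη (not_lt.2 hhω)

theorem commute_of_forall_unitary (K : VonNeumannAlgebra H) {w : H →L[ℂ] H}
    (h : ∀ u ∈ K, u ∈ unitary (H →L[ℂ] H) → w * u = u * w) : ∀ k ∈ K, w * k = k * w := by
  have key : ∀ a ∈ K, IsSelfAdjoint a → ‖a‖ ≤ 1 → w * a = a * w := by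
    intro a ha hsa hn
    have hu := hsa.self_add_I_smul_cfcSqrt_sub_sq_mem_unitary a hn
    have hsq : 0 ≤ 1 - a ^ 2 := by
      have := star_mul_self_le_one hn
      rw [hsa.star_eq, ← sq] at this
      exact sub_nonneg.2 this
    have hsK : CFC.sqrt (1 - a ^ 2) ∈ K := K.sqrt_mem (sub_mem (one_mem K) (pow_mem ha 2)) hsq
    set s := CFC.sqrt (1 - a ^ 2) with hs
    have hss : star s = s := (CFC.sqrt_nonneg _).isSelfAdjoint
    have huK : a + Complex.I • s ∈ K := add_mem ha (K.smul_mem _ hsK)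
    have h1 := h _ huK hu
    have h2 := h _ (star_mem huK) (Unitary.star_mem hu)
    have e : a = (1 / 2 : ℝ) • ((a + Complex.I • s) + star (a + Complex.I • s)) := by
      rw [star_add, star_smul, hsa.star_eq, hss, Complex.star_def, Complex.conj_I]
      module
    rw [e, mul_smul_comm, smul_mul_assoc, mul_add, add_mul, h1, h2]
  have key2 : ∀ a ∈ K, IsSelfAdjoint a → w * a = a * w := by
    intro a ha hsa
    rcases eq_or_ne a 0 with rfl | h0
    · rw [mul_zero, zero_mul]
    have hn : ‖a‖ ≠ 0 := norm_ne_zero_iff.2 h0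
    have h1 := key (‖a‖⁻¹ • a) (K.real_smul_mem_s16 _ ha) (by
      change star _ = _
      rw [star_smul, hsa.star_eq, star_trivial]) (by
      rw [norm_smul, norm_inv, norm_norm, inv_mul_cancel₀ hn])
    rw [mul_smul_comm, smul_mul_assoc] at h1
    exact smul_right_injective _ (inv_ne_zero hn) h1
  intro k hk
  obtain ⟨a, ha, b, hb, has, hbs, rfl, -, -⟩ := IsFaithfulTrace.exists_re_im hk
  rw [mul_add, add_mul, mul_smul_comm, smul_mul_assoc, key2 a ha has, key2 b hb hbs]

theorem eq_zero_of_le_mul_star {a δ : H →L[ℂ] H} (ha0 : 0 ≤ a) (hak : a ≤ δ * star δ)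
    (h2 : a * δ = 0) : a = 0 := by
  have has : star a = a := ha0.isSelfAdjoint
  have h3 : a * a * a ≤ 0 := by
    have := star_left_conjugate_le_conjugate hak a
    rwa [has, ← mul_assoc a δ, h2, zero_mul, zero_mul] at this
  have h4 : 0 ≤ a * a * a := by
    have := star_left_conjugate_nonneg ha0 a
    rwa [has] at this
  have h5 := le_antisymm h3 h4
  have h6 : star (a * a) * (a * a) = 0 := by
    rw [star_mul, has, ← mul_assoc, h5, zero_mul]
  rw [CStarRing.star_mul_self_eq_zero_iff] at h6
  rw [← CStarRing.star_mul_self_eq_zero_iff, has, h6]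

/-- An increasing net of positive contractions in the normal part. -/
def normalNet (M : VonNeumannAlgebra H) (τ : (H →L[ℂ] H) →ₗ[ℂ] ℂ) : Set (H →L[ℂ] H) :=
  {b | ∃ a ∈ M.normalPart τ, 0 ≤ a ∧ b = cfcₙ (fun x : ℝ => 1 - (1 + x)⁻¹) a}

theorem continuousOn_spectrum_one_sub {a : H →L[ℂ] H} (ha : 0 ≤ a) :
    ContinuousOn (fun x : ℝ => 1 - (1 + x)⁻¹) (spectrum ℝ a) := by
  refine continuousOn_const.sub (ContinuousOn.inv₀ (by fun_prop) fun x hx => ?_)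
  have := spectrum_nonneg_of_nonneg ha hx
  positivity

theorem cfcₙ_one_sub_eq_cfc {a : H →L[ℂ] H} (ha : 0 ≤ a) :
    cfcₙ (fun x : ℝ => 1 - (1 + x)⁻¹) a = cfc (fun x : ℝ => 1 - (1 + x)⁻¹) a := by
  refine cfcₙ_eq_cfc ?_ (by norm_num)
  rw [quasispectrum_eq_spectrum_union_zero]
  refine continuousOn_const.sub (ContinuousOn.inv₀ (by fun_prop) ?_)
  rintro x (hx | rfl)
  · have := spectrum_nonneg_of_nonneg ha hx
    positivity
  · norm_num

theorem cfc_one_sub_mul {a : H →L[ℂ] H} (ha : 0 ≤ a) :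
    cfcₙ (fun x : ℝ => 1 - (1 + x)⁻¹) a + a * cfcₙ (fun x : ℝ => 1 - (1 + x)⁻¹) a = a := by
  have hc := continuousOn_spectrum_one_sub ha
  have hsa := ha.isSelfAdjoint
  rw [cfcₙ_one_sub_eq_cfc ha]
  have e1 : a * cfc (fun x : ℝ => 1 - (1 + x)⁻¹) a =
      cfc (fun x : ℝ => x * (1 - (1 + x)⁻¹)) a := by
    rw [cfc_mul (fun x : ℝ => x) _ a (by fun_prop) hc, cfc_id' ℝ a]
  rw [e1, ← cfc_add a _ (fun x : ℝ => x * (1 - (1 + x)⁻¹)) hc (ContinuousOn.mul (by fun_prop) hc)]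
  conv_rhs => rw [← cfc_id' ℝ a]
  refine cfc_congr fun x hx => ?_
  have := spectrum_nonneg_of_nonneg ha hx
  have h2 : 1 + x ≠ 0 := by positivity
  field_simp
  ring

namespace normalNet

theorem mem_normalPart {b : H →L[ℂ] H} (hb : b ∈ M.normalNet τ) : b ∈ M.normalPart τ := by
  obtain ⟨a, ha, ha0, rfl⟩ := hb
  have hsa := ha0.isSelfAdjoint
  have hmem : cfc (fun x : ℝ => 1 - (1 + x)⁻¹) a ∈ M := M.cfc_mem_s16 _ ha.1 hsa
  have e := cfc_one_sub_mul ha0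
  rw [cfcₙ_one_sub_eq_cfc ha0] at e ⊢
  rw [eq_sub_of_add_eq e, sub_eq_add_neg, ← neg_one_smul ℂ (a * _)]
  exact normalPart.add ha (normalPart.smul _ (normalPart.mul_right ha hmem))

theorem nonneg {b : H →L[ℂ] H} (hb : b ∈ M.normalNet τ) : 0 ≤ b := by
  obtain ⟨a, ha, ha0, rfl⟩ := hb
  rw [cfcₙ_one_sub_eq_cfc ha0]
  refine cfc_nonneg fun x hx => ?_
  have := spectrum_nonneg_of_nonneg ha0 hx
  rw [sub_nonneg]
  exact inv_le_one_of_one_le₀ (by linarith)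

theorem le_one {b : H →L[ℂ] H} (hb : b ∈ M.normalNet τ) : b ≤ 1 := by
  obtain ⟨a, ha, ha0, rfl⟩ := hb
  rw [cfcₙ_one_sub_eq_cfc ha0]
  refine cfc_le_one _ _ fun x hx => ?_
  have := spectrum_nonneg_of_nonneg ha0 hx
  have h2 : 0 ≤ (1 + x)⁻¹ := by positivity
  linarith

theorem exists_ge {b c : H →L[ℂ] H} (hb : b ∈ M.normalNet τ) (hc : c ∈ M.normalNet τ) :
    ∃ d ∈ M.normalNet τ, b ≤ d ∧ c ≤ d := by
  obtain ⟨x, hx, hx0, rfl⟩ := hb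
  obtain ⟨y, hy, hy0, rfl⟩ := hc
  have hxy := add_nonneg hx0 hy0
  refine ⟨_, ⟨x + y, normalPart.add hx hy, hxy, rfl⟩, ?_, ?_⟩
  · exact CFC.monotoneOn_one_sub_one_add_inv_real hx0 hxy (le_add_of_nonneg_right hy0)
  · exact CFC.monotoneOn_one_sub_one_add_inv_real hy0 hxy (le_add_of_nonneg_left hx0)

theorem conj (hτ : M.IsFaithfulTrace τ) {b u : H →L[ℂ] H} (hb : b ∈ M.normalNet τ) (hu : u ∈ M)
    (hu' : u ∈ unitary (H →L[ℂ] H)) : star u * b * u ∈ M.normalNet τ := by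
  obtain ⟨a, ha, ha0, rfl⟩ := hb
  have hc0 := star_left_conjugate_nonneg ha0 u
  refine ⟨star u * a * u, normalPart.mul_right (normalPart.mul_left hτ ha (star_mem hu)) hu,
    hc0, ?_⟩
  have hc := continuousOn_spectrum_one_sub ha0
  have hsa := ha0.isSelfAdjoint
  let U : unitary (H →L[ℂ] H) := star ⟨u, hu'⟩
  let φ := Unitary.conjStarAlgAut ℝ (H →L[ℂ] H) U
  have hφ : ∀ x, φ x = star u * x * u := fun x => by
    simp [φ, U, Unitary.conjStarAlgAut_apply]
  have hφc : Continuous φ := by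
    have : (φ : (H →L[ℂ] H) → (H →L[ℂ] H)) = fun x => star u * x * u := funext hφ
    rw [this]
    fun_prop
  have := StarAlgHomClass.map_cfc φ (fun x : ℝ => 1 - (1 + x)⁻¹) a hc hφc hsa
    (by rw [hφ]; exact hc0.isSelfAdjoint)
  rw [hφ, hφ] at this
  rw [cfcₙ_one_sub_eq_cfc ha0, this, cfcₙ_one_sub_eq_cfc hc0]

theorem eq_zero (hτ : M.IsFaithfulTrace τ) {δ : H →L[ℂ] H} (hδ : δ ∈ M)
    (h : ∀ b ∈ M.normalNet τ, b * δ = 0) : δ = 0 := by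
  by_contra hne
  obtain ⟨a, ha, ha0, hak, hane⟩ := exists_mem_normalPart_le hτ (mul_mem hδ (star_mem hδ))
    (mul_star_self_nonneg δ) (by rwa [ne_eq, CStarRing.mul_star_self_eq_zero_iff])
  apply hane
  have h1 := h _ ⟨a, ha, ha0, rfl⟩
  have h2 : a * δ = 0 := by
    conv_lhs => rw [← cfc_one_sub_mul ha0]
    rw [add_mul, mul_assoc, h1, mul_zero, add_zero]
  exact eq_zero_of_le_mul_star ha0 hak h2

end normalNet

theorem normalNet.zero_mem : (0 : H →L[ℂ] H) ∈ M.normalNet τ := by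
  refine ⟨0, ⟨ZeroMemClass.zero_mem M, fun r => ?_⟩, le_rfl, by simp⟩
  simp only [zero_mul, map_zero]
  exact continuousOn_const

/-- The quadratic form of the density `b`. -/
noncomputable def weightedForm (τ : (H →L[ℂ] H) →ₗ[ℂ] ℂ) (b x : H →L[ℂ] H) : ℝ :=
  (τ (star x * b * x)).re

theorem weightedForm_midpoint (b x y : H →L[ℂ] H) :
    weightedForm τ b ((1 / 2 : ℝ) • (x + y)) + weightedForm τ b ((1 / 2 : ℝ) • (x - y)) =
      1 / 2 * (weightedForm τ b x + weightedForm τ b y) := by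
  have e : star ((1 / 2 : ℝ) • (x + y)) * b * ((1 / 2 : ℝ) • (x + y)) +
      star ((1 / 2 : ℝ) • (x - y)) * b * ((1 / 2 : ℝ) • (x - y)) =
      ((1 / 2 : ℝ) : ℂ) • (star x * b * x + star y * b * y) := by
    rw [Complex.coe_smul]
    simp only [star_smul, star_add, star_sub, star_trivial, smul_mul_assoc, mul_smul_comm, add_mul,
      sub_mul, mul_add, mul_sub]
    module
  rw [weightedForm, weightedForm, weightedForm, weightedForm, ← Complex.add_re, ← map_add, e,
    map_smul, smul_eq_mul, Complex.re_ofReal_mul, map_add, Complex.add_re]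

theorem IsFaithfulTrace.weightedForm_nonneg (hτ : M.IsFaithfulTrace τ) {b x : H →L[ℂ] H}
    (hb : b ∈ M) (hb0 : 0 ≤ b) (hx : x ∈ M) : 0 ≤ weightedForm τ b x :=
  (Complex.nonneg_iff.1 (hτ.nonneg (mul_mem (mul_mem (star_mem hx) hb) hx)
    (star_left_conjugate_nonneg hb0 x))).1

theorem IsFaithfulTrace.weightedForm_mono (hτ : M.IsFaithfulTrace τ) {b c x : H →L[ℂ] H}
    (hb : b ∈ M) (hc : c ∈ M) (hbc : b ≤ c) (hx : x ∈ M) :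
    weightedForm τ b x ≤ weightedForm τ c x :=
  hτ.re_mono (mul_mem (mul_mem (star_mem hx) hb) hx) (mul_mem (mul_mem (star_mem hx) hc) hx)
    (star_left_conjugate_le_conjugate hbc x)

theorem IsFaithfulTrace.weightedForm_ge (hτ : M.IsFaithfulTrace τ) {b x y : H →L[ℂ] H}
    (hb : b ∈ M) (hb0 : 0 ≤ b) (hx : x ∈ M) (hy : y ∈ M) :
    2 * (τ (star y * b * x)).re - weightedForm τ b y ≤ weightedForm τ b x := by
  have h := hτ.weightedForm_nonneg hb hb0 (sub_mem hx hy)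
  have h1 : star (star y * b * x) = star x * b * y := by
    rw [star_mul, star_mul, star_star, hb0.isSelfAdjoint.star_eq, mul_assoc]
  have h2 := hτ.map_star (mul_mem (mul_mem (star_mem hy) hb) hx)
  rw [h1] at h2
  have e : star (x - y) * b * (x - y) =
      star x * b * x - star x * b * y - star y * b * x + star y * b * y := by
    rw [star_sub]
    noncomm_ring
  rw [weightedForm, e, map_add, map_sub, map_sub, h2, Complex.add_re, Complex.sub_re,
    Complex.sub_re, Complex.star_def, Complex.conj_re] at h
  rw [weightedForm, weightedForm]
  linarith

theorem IsFaithfulTrace.eq_zero_of_weightedForm (hτ : M.IsFaithfulTrace τ) {b x : H →L[ℂ] H}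
    (hb : b ∈ M) (hb0 : 0 ≤ b) (hx : x ∈ M) (h : weightedForm τ b x ≤ 0) : b * x = 0 := by
  obtain ⟨s, hs⟩ : ∃ s, s = CFC.sqrt b := ⟨_, rfl⟩
  have hsM : s ∈ M := hs ▸ M.sqrt_mem hb hb0
  have hss : star s = s := by rw [hs]; exact (CFC.sqrt_nonneg b).isSelfAdjoint
  have hsb : s * s = b := by rw [hs]; exact CFC.sqrt_mul_sqrt_self b hb0
  have e : star (s * x) * (s * x) = star x * b * x := by
    rw [star_mul, hss, ← hsb]
    noncomm_ring
  have h1 := hτ.pos _ (mul_mem hsM hx)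
  have h2 : τ (star (s * x) * (s * x)) = 0 := by
    refine Complex.ext ?_ (Complex.nonneg_iff.1 h1).2.symm
    refine le_antisymm ?_ (Complex.nonneg_iff.1 h1).1
    rw [e]
    exact h
  rw [← hsb, mul_assoc, hτ.faithful _ (mul_mem hsM hx) h2, mul_zero]

theorem IsFaithfulTrace.lowerSemicontinuousOn_weightedForm (hτ : M.IsFaithfulTrace τ)
    {b : H →L[ℂ] H} (hb : b ∈ M.normalPart τ) (hb0 : 0 ≤ b) (r : ℝ) :
    LowerSemicontinuousOn (fun A : H →WOT[ℂ] H => weightedForm τ b A.toCLM)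
      {A | A.toCLM ∈ M ∧ ‖A.toCLM‖ ≤ r} := by
  intro A hA y hy
  have hc := (normalPart.mul_left hτ hb (star_mem hA.1)).2 r
  have hc' : ContinuousOn (fun B : H →WOT[ℂ] H =>
      2 * (τ (star A.toCLM * b * B.toCLM)).re - weightedForm τ b A.toCLM)
      {A | A.toCLM ∈ M ∧ ‖A.toCLM‖ ≤ r} :=
    ((Complex.continuous_re.comp_continuousOn hc).const_mul 2).sub continuousOn_const
  have h1 := (hc' A hA).eventually_const_lt (u := y) (by
    change y < 2 * weightedForm τ b A.toCLM - _
    rw [two_mul, add_sub_cancel_right]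
    exact hy)
  filter_upwards [h1, self_mem_nhdsWithin] with B hB hB'
  exact hB.trans_le (hτ.weightedForm_ge hb.1 hb0 hB'.1 hA.1)

/-- A weak operator compact midpoint-convex subset of `M` has a point fixed by all unitaries of `M`
whose conjugation preserves it. -/
theorem IsFaithfulTrace.exists_fixed_point (hτ : M.IsFaithfulTrace τ) {C : Set (H →L[ℂ] H)}
    (hC : IsCompact {A : H →WOT[ℂ] H | A.toCLM ∈ C}) (hne : C.Nonempty) {r : ℝ}
    (hCM : ∀ x ∈ C, x ∈ M ∧ ‖x‖ ≤ r)
    (hmid : ∀ x ∈ C, ∀ y ∈ C, (1 / 2 : ℝ) • (x + y) ∈ C) :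
    ∃ w ∈ C, ∀ u ∈ M, u ∈ unitary (H →L[ℂ] H) → (∀ x ∈ C, u * x * star u ∈ C) →
      u * w * star u = w := by
  have hbdd : ∀ x ∈ C,
      BddAbove (Set.range fun b : M.normalNet τ => weightedForm τ (b : H →L[ℂ] H) x) := by
    refine fun x hx => ⟨weightedForm τ 1 x, ?_⟩
    rintro _ ⟨b, rfl⟩
    exact hτ.weightedForm_mono (normalNet.mem_normalPart b.2).1 (one_mem M) (normalNet.le_one b.2)
      (hCM x hx).1
  have : Nonempty (M.normalNet τ) := ⟨⟨0, normalNet.zero_mem⟩⟩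
  let g : (H →L[ℂ] H) → ℝ := fun x => ⨆ b : M.normalNet τ, weightedForm τ (b : H →L[ℂ] H) x
  have hlsc : LowerSemicontinuousOn (fun A : H →WOT[ℂ] H => g A.toCLM) {A | A.toCLM ∈ C} :=
    lowerSemicontinuousOn_ciSup (fun A hA => hbdd _ hA) fun b =>
      (hτ.lowerSemicontinuousOn_weightedForm (normalNet.mem_normalPart b.2)
        (normalNet.nonneg b.2) r).mono fun A hA => hCM _ hA
  obtain ⟨A, hA, hmin⟩ := LowerSemicontinuousOn.exists_isMinOn
    (by obtain ⟨x, hx⟩ := hne; exact ⟨.ofCLM x, hx⟩) hC hlsc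
  obtain ⟨w, hw⟩ : ∃ w, w = A.toCLM := ⟨_, rfl⟩
  have hwC : w ∈ C := hw ▸ hA
  have hwmin : ∀ x ∈ C, g w ≤ g x := fun x hx => by
    rw [hw]
    exact hmin (a := .ofCLM x) hx
  refine ⟨w, hwC, fun u hu huu hinv => ?_⟩
  have hvC := hinv w hwC
  have hvw : g (u * w * star u) ≤ g w := by
    refine ciSup_le fun b => ?_
    have e : weightedForm τ (b : H →L[ℂ] H) (u * w * star u) =
        weightedForm τ (star u * b * u) w := by
      have hwM := (hCM w hwC).1
      have hbM := (normalNet.mem_normalPart b.2).1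
      rw [weightedForm, weightedForm]
      have e1 : star (u * w * star u) * b * (u * w * star u) =
          u * (star w * star u * b * u * w * star u) := by
        simp only [star_mul, star_star, mul_assoc]
      rw [e1, hτ.comm u hu _ (mul_mem (mul_mem (mul_mem (mul_mem (mul_mem (star_mem hwM)
        (star_mem hu)) hbM) hu) hwM) (star_mem hu)), mul_assoc _ (star u) u,
        Unitary.star_mul_self_of_mem huu, mul_one]
      simp only [mul_assoc]
    rw [e]
    exact le_ciSup (hbdd w hwC) ⟨_, normalNet.conj hτ b.2 hu huu⟩
  set v := u * w * star u with hv
  have hδM : (1 / 2 : ℝ) • (v - w) ∈ M := M.real_smul_mem_s16 _ (sub_mem (hCM v hvC).1 (hCM w hwC).1)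
  have hδ : (1 / 2 : ℝ) • (v - w) = 0 := by
    refine normalNet.eq_zero hτ hδM fun b hb => ?_
    have hbJ := normalNet.mem_normalPart hb
    refine hτ.eq_zero_of_weightedForm hbJ.1 (normalNet.nonneg hb) hδM ?_
    have h1 : g ((1 / 2 : ℝ) • (v + w)) ≤ g w - weightedForm τ b ((1 / 2 : ℝ) • (v - w)) := by
      refine ciSup_le fun c => ?_
      obtain ⟨d, hd, hbd, hcd⟩ := normalNet.exists_ge hb c.2
      have hdM := (normalNet.mem_normalPart hd).1
      have h2 := weightedForm_midpoint (τ := τ) d v w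
      have h3 := hτ.weightedForm_mono hbJ.1 hdM hbd hδM
      have h4 := hτ.weightedForm_mono (normalNet.mem_normalPart c.2).1 hdM hcd
        (hCM _ (hmid v hvC w hwC)).1
      have h5 : weightedForm τ d v ≤ g v := le_ciSup (hbdd v hvC) ⟨d, hd⟩
      have h6 : weightedForm τ d w ≤ g w := le_ciSup (hbdd w hwC) ⟨d, hd⟩
      linarith
    have h2 := hwmin _ (hmid v hvC w hwC)
    linarith
  rw [smul_eq_zero, sub_eq_zero] at hδ
  exact hδ.resolve_left (by norm_num)

theorem IsFaithfulTrace.exists_commuting (hτ : M.IsFaithfulTrace τ) {K K₁ : VonNeumannAlgebra H}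
    (hK : ∀ x ∈ K, x ∈ K₁) (hK₁ : ∀ x ∈ K₁, x ∈ M) {y : H →L[ℂ] H} (hy : y ∈ K₁) :
    ∃ w ∈ K₁, (∀ k ∈ K, w * k = k * w) ∧
      ∀ b ∈ M.normalPart τ, (∀ k ∈ K, b * k = k * b) → τ (b * w) = τ (b * y) := by
  let C : Set (H →L[ℂ] H) := {x | (x ∈ K₁ ∧ ‖x‖ ≤ ‖y‖) ∧
    ∀ b ∈ M.normalPart τ, (∀ k ∈ K, b * k = k * b) → τ (b * x) = τ (b * y)}
  have hC : IsCompact {A : H →WOT[ℂ] H | A.toCLM ∈ C} := by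
    refine (isCompact_wot_ball_s16 ‖y‖).of_isClosed_subset ?_ fun A hA => hA.1.2
    have e : {A : H →WOT[ℂ] H | A.toCLM ∈ C} = {A | A.toCLM ∈ K₁ ∧ ‖A.toCLM‖ ≤ ‖y‖} ∩
        ⋂ (b ∈ M.normalPart τ) (_ : ∀ k ∈ K, b * k = k * b), ({A | A.toCLM ∈ K₁ ∧ ‖A.toCLM‖ ≤ ‖y‖} ∩
          (fun A : H →WOT[ℂ] H => τ (b * A.toCLM)) ⁻¹' {τ (b * y)}) := by
      ext A
      simp only [C, Set.mem_inter_iff, Set.mem_iInter, Set.mem_preimage, Set.mem_singleton_iff,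
        Set.mem_ofPred_eq]
      grind
    have hcl : IsClosed {A : H →WOT[ℂ] H | A.toCLM ∈ K₁ ∧ ‖A.toCLM‖ ≤ ‖y‖} :=
      (isClosed_wot_mem K₁).inter (isCompact_wot_ball_s16 ‖y‖).isClosed
    rw [e]
    refine hcl.inter (isClosed_biInter fun b hb => isClosed_iInter fun _ => ?_)
    exact ((hb.2 ‖y‖).mono fun A hA => ⟨hK₁ _ hA.1, hA.2⟩).preimage_isClosed_of_isClosed hcl
      isClosed_singleton
  obtain ⟨w, hwC, hw⟩ := hτ.exists_fixed_point hC ⟨y, ⟨hy, le_rfl⟩, fun _ _ _ => rfl⟩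
    (fun x hx => ⟨hK₁ x hx.1.1, hx.1.2⟩) (by
    rintro x ⟨⟨hx, hxn⟩, hxb⟩ z ⟨⟨hz, hzn⟩, hzb⟩
    refine ⟨⟨K₁.real_smul_mem_s16 _ (add_mem hx hz), ?_⟩, fun b hb hbK => ?_⟩
    · rw [norm_smul]
      have := norm_add_le x z
      norm_num
      linarith
    · rw [mul_smul_comm, mul_add, ← Complex.coe_smul, map_smul, map_add, hxb b hb hbK,
        hzb b hb hbK, smul_eq_mul]
      push_cast
      ring)
  refine ⟨w, hwC.1.1, commute_of_forall_unitary K fun u hu huu => ?_, hwC.2⟩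
  have h := hw u (hK₁ _ (hK _ hu)) huu (by
    rintro x ⟨⟨hx, hxn⟩, hxb⟩
    refine ⟨⟨mul_mem (mul_mem (hK _ hu) hx) (star_mem (hK _ hu)), ?_⟩, fun b hb hbK => ?_⟩
    · refine le_trans (le_of_eq ?_) hxn
      have h1 := CStarRing.norm_mul_coe_unitary (u * x) (star (⟨u, huu⟩ : unitary (H →L[ℂ] H)))
      have h2 := CStarRing.norm_coe_unitary_mul (⟨u, huu⟩ : unitary (H →L[ℂ] H)) x
      exact h1.trans h2
    · have huM := hK₁ _ (hK _ hu)
      have e : b * (u * x * star u) = u * (b * x * star u) := by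
        rw [← mul_assoc, ← mul_assoc, hbK u hu]
        simp only [mul_assoc]
      rw [e, hτ.comm u huM _ (mul_mem (mul_mem hb.1 (hK₁ _ hx)) (star_mem huM)), mul_assoc,
        Unitary.star_mul_self_of_mem huu, mul_one, hxb b hb hbK])
  conv_lhs => rw [← h, mul_assoc, Unitary.star_mul_self_of_mem huu, mul_one]

theorem IsFaithfulTrace.exists_center_of_isSelfAdjoint (hτ : M.IsFaithfulTrace τ) {a : H →L[ℂ] H}
    (ha : a ∈ M) (hsa : IsSelfAdjoint a) :
    ∃ c ∈ M, (∀ m ∈ M, m * c = c * m) ∧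
      (∀ d ∈ M, (∀ m ∈ M, m * d = d * m) → τ (d * c) = τ (d * a)) ∧
      (a ∈ M.normalPart τ → c ∈ M.normalPart τ) := by
  obtain ⟨c, hc, hP⟩ := M.exists_central_average ha hsa
  have h1 := hP {x | x ∈ M ∧ ∀ d ∈ M, (∀ m ∈ M, m * d = d * m) → τ (d * x) = τ (d * a)} (by
    rw [← isSeqClosed_iff_isClosed]
    intro x y hx hy
    have hyM : y ∈ M := (isClosed_coe M).mem_of_tendsto hy (.of_forall fun n => (hx n).1)
    refine ⟨hyM, fun d hd hdc => ?_⟩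
    have h0 : Tendsto (fun n => 2 * (τ 1).re * (‖d‖ * ‖y - x n‖)) atTop (𝓝 0) := by
      have : Tendsto (fun n => ‖y - x n‖) atTop (𝓝 0) := by
        simpa using (tendsto_const_nhds (x := y)).sub hy |>.norm
      simpa using (this.const_mul ‖d‖).const_mul (2 * (τ 1).re)
    have h1 : 0 ≤ (τ 1).re := (Complex.nonneg_iff.1 (hτ.nonneg (one_mem M) zero_le_one)).1
    have h2 : ‖τ (d * y) - τ (d * a)‖ ≤ 0 := by
      refine ge_of_tendsto' h0 fun n => ?_
      rw [← (hx n).2 d hd hdc, ← map_sub, ← mul_sub]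
      refine (hτ.norm_le (mul_mem hd (sub_mem hyM (hx n).1))).trans ?_
      gcongr
      exact norm_mul_le _ _
    rwa [norm_le_zero_iff, sub_eq_zero] at h2) (by
    rintro x ⟨hx, hxd⟩ y ⟨hy, hyd⟩ s t - - hst
    refine ⟨add_mem (M.real_smul_mem_s16 s hx) (M.real_smul_mem_s16 t hy), fun d hd hdc => ?_⟩
    rw [mul_add, mul_smul_comm, mul_smul_comm, ← Complex.coe_smul, ← Complex.coe_smul, map_add,
      map_smul, map_smul, hxd d hd hdc, hyd d hd hdc, ← add_smul, ← Complex.ofReal_add, hst,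
      Complex.ofReal_one, one_smul]) (fun u hu huu => by
    refine ⟨mul_mem (mul_mem hu ha) (star_mem hu), fun d hd hdc => ?_⟩
    have e : d * (u * a * star u) = u * (d * a * star u) := by
      rw [← mul_assoc, ← mul_assoc, ← hdc u hu]
      simp only [mul_assoc]
    rw [e, hτ.comm u hu _ (mul_mem (mul_mem hd ha) (star_mem hu)), mul_assoc,
      Unitary.star_mul_self_of_mem huu, mul_one])
  exact ⟨c, h1.1, hc, h1.2, fun haJ => hP _ (normalPart.isClosed hτ) normalPart.convex
    fun u hu _ => normalPart.mul_right (normalPart.mul_left hτ haJ hu) (star_mem hu)⟩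

theorem IsFaithfulTrace.exists_center (hτ : M.IsFaithfulTrace τ) {a : H →L[ℂ] H} (ha : a ∈ M) :
    ∃ c ∈ M, (∀ m ∈ M, m * c = c * m) ∧
      ∀ d ∈ M, (∀ m ∈ M, m * d = d * m) → τ (d * c) = τ (d * a) := by
  obtain ⟨x, hx, y, hy, hxs, hys, rfl, -, -⟩ := exists_re_im ha
  obtain ⟨p, hp, hpc, hpd, -⟩ := hτ.exists_center_of_isSelfAdjoint hx hxs
  obtain ⟨q, hq, hqc, hqd, -⟩ := hτ.exists_center_of_isSelfAdjoint hy hys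
  refine ⟨p + Complex.I • q, add_mem hp (M.smul_mem _ hq), fun m hm => ?_, fun d hd hdc => ?_⟩
  · rw [mul_add, add_mul, mul_smul_comm, smul_mul_assoc, hpc m hm, hqc m hm]
  · rw [mul_add, mul_add, mul_smul_comm, mul_smul_comm, map_add, map_add, map_smul, map_smul,
      hpd d hd hdc, hqd d hd hdc]

/-- Functionals `τ (b * ·)` with `b` commuting with `K` are determined by those with `b` in the
normal part. -/
theorem IsFaithfulTrace.map_mul_eq_of_normalPart (hτ : M.IsFaithfulTrace τ)
    {K : VonNeumannAlgebra H} (hK : ∀ x ∈ K, x ∈ M) {y w z : H →L[ℂ] H} (hy : y ∈ M) (hw : w ∈ M)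
    (h : ∀ b ∈ M.normalPart τ, (∀ k ∈ K, b * k = k * b) → τ (b * w) = τ (b * y))
    (hz : z ∈ M) (hzK : ∀ k ∈ K, z * k = k * z) : τ (z * w) = τ (z * y) := by
  have htM : z * (w - y) ∈ M := mul_mem hz (sub_mem hw hy)
  obtain ⟨c, hc, hcc, hcd⟩ := hτ.exists_center htM
  have hcc' : ∀ m ∈ M, m * star c = star c * m := fun m hm => by
    have := congrArg star (hcc (star m) (star_mem hm))
    rw [star_mul, star_mul, star_star] at this
    exact this.symm
  have hc0 : star c = 0 := by
    by_contra hne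
    obtain ⟨b, hb, hb0, hbk, hbne⟩ := exists_mem_normalPart_le hτ
      (mul_mem (star_mem hc) (star_mem (star_mem hc))) (mul_star_self_nonneg (star c))
      (by rwa [ne_eq, CStarRing.mul_star_self_eq_zero_iff])
    refine hbne (eq_zero_of_le_mul_star hb0 hbk
      (hτ.eq_zero_of_weightedForm hb.1 hb0 (star_mem hc) (le_of_eq ?_)))
    obtain ⟨p, hp, hpc, hpd, hpJ⟩ := hτ.exists_center_of_isSelfAdjoint hb.1 hb0.isSelfAdjoint
    have h1 := h (p * star c * z) (normalPart.mul_right (normalPart.mul_right (hpJ hb)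
      (star_mem hc)) hz) fun k hk => by
        rw [mul_assoc, hzK k hk, mul_assoc p, ← mul_assoc (star c) k, ← hcc' k (hK k hk),
          ← mul_assoc, ← mul_assoc, ← hpc k (hK k hk)]
        simp only [mul_assoc]
    have h2 : τ (p * star c * c) = 0 := by
      rw [hcd _ (mul_mem hp (star_mem hc)) fun m hm => by
        rw [← mul_assoc, hpc m hm, mul_assoc, hcc' m hm, mul_assoc], ← mul_assoc, mul_sub, map_sub,
        h1, sub_self]
    have h3 := hpd (star c * c) (mul_mem (star_mem hc) hc) fun m hm => by
        rw [← mul_assoc, hcc' m hm, mul_assoc, hcc m hm, mul_assoc]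
    rw [hτ.comm _ (mul_mem (star_mem hc) hc) p hp, ← mul_assoc, h2, mul_assoc,
      hτ.comm _ (star_mem hc) _ (mul_mem hc hb.1)] at h3
    rw [weightedForm, star_star, ← h3, Complex.zero_re]
  have h1 := hcd 1 (one_mem M) fun m _ => by rw [mul_one, one_mul]
  rw [star_eq_zero] at hc0
  rw [hc0, mul_zero, map_zero, one_mul, mul_sub, map_sub] at h1
  exact (sub_eq_zero.1 h1.symm)

end

end VonNeumannAlgebra

/-- For von Neumann subalgebras `N ⊆ K ⊆ K₁ ⊆ M₁` and `N ⊆ L ⊆ M ⊆ M₁` with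
`K ⊆ M`, `N'∩K₁ ⊆ L'∩M₁` and `K'∩K₁ ⊆ M'∩M₁`, of a von Neumann algebra `M₁` with faithful
tracial state `τ`, assuming the `τ`-preserving conditional expectations onto the relevant
relative commutants exist, the quadruple with top row `N'∩K₁ ⊆ L'∩M₁` and bottom row
`K'∩K₁ ⊆ M'∩M₁` is a commuting square: for every `x ∈ M'∩M₁`, `E_{N'∩K₁}(x) ∈ K'∩K₁` and
`E_{N'∩K₁}(x) = E_{K'∩K₁}(x)`. -/
theorem stmt_16
    {H : Type*} [NormedAddCommGroup H] [InnerProductSpace ℂ H] [CompleteSpace H]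
    (M1 K1 K N L M : VonNeumannAlgebra H)
    (hNK : ∀ x, x ∈ N → x ∈ K) (hKK1 : ∀ x, x ∈ K → x ∈ K1)
    (hK1M1 : ∀ x, x ∈ K1 → x ∈ M1)
    (hNL : ∀ x, x ∈ N → x ∈ L) (hLM : ∀ x, x ∈ L → x ∈ M)
    (hMM1 : ∀ x, x ∈ M → x ∈ M1) (hKM : ∀ x, x ∈ K → x ∈ M)
    -- `N'∩K₁ ⊆ L'∩M₁`:
    (hrel1 : ∀ x, (x ∈ K1 ∧ ∀ n ∈ N, x * n = n * x) →
      (x ∈ M1 ∧ ∀ l ∈ L, x * l = l * x))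
    -- `K'∩K₁ ⊆ M'∩M₁`:
    (hrel2 : ∀ x, (x ∈ K1 ∧ ∀ k ∈ K, x * k = k * x) →
      (x ∈ M1 ∧ ∀ m ∈ M, x * m = m * x))
    (τ : (H →L[ℂ] H) →ₗ[ℂ] ℂ)
    (hτ1 : τ 1 = 1)
    (hτpos : ∀ x ∈ M1, 0 ≤ τ (star x * x))
    (hτfaith : ∀ x ∈ M1, τ (star x * x) = 0 → x = 0)
    (hτtr : ∀ x ∈ M1, ∀ y ∈ M1, τ (x * y) = τ (y * x))
    -- the `τ`-preserving conditional expectations onto the relevant relative commutants: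
    (ENK1 EKK1 ELM1 EMM1 : (H →L[ℂ] H) →ₗ[ℂ] (H →L[ℂ] H))
    (hENK1mem : ∀ x ∈ M1, ENK1 x ∈ K1 ∧ ∀ n ∈ N, ENK1 x * n = n * ENK1 x)
    (hENK1 : ∀ x ∈ M1, ∀ y, (y ∈ K1 ∧ ∀ n ∈ N, y * n = n * y) →
      τ (ENK1 x * y) = τ (x * y))
    (hEKK1mem : ∀ x ∈ M1, EKK1 x ∈ K1 ∧ ∀ k ∈ K, EKK1 x * k = k * EKK1 x)
    (hEKK1 : ∀ x ∈ M1, ∀ y, (y ∈ K1 ∧ ∀ k ∈ K, y * k = k * y) →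
      τ (EKK1 x * y) = τ (x * y))
    (hELM1mem : ∀ x ∈ M1, ELM1 x ∈ M1 ∧ ∀ l ∈ L, ELM1 x * l = l * ELM1 x)
    (hELM1 : ∀ x ∈ M1, ∀ y, (y ∈ M1 ∧ ∀ l ∈ L, y * l = l * y) →
      τ (ELM1 x * y) = τ (x * y))
    (hEMM1mem : ∀ x ∈ M1, EMM1 x ∈ M1 ∧ ∀ m ∈ M, EMM1 x * m = m * EMM1 x)
    (hEMM1 : ∀ x ∈ M1, ∀ y, (y ∈ M1 ∧ ∀ m ∈ M, y * m = m * y) →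
      τ (EMM1 x * y) = τ (x * y)) :
    ∀ x, (x ∈ M1 ∧ ∀ m ∈ M, x * m = m * x) →
      (ENK1 x ∈ K1 ∧ ∀ k ∈ K, ENK1 x * k = k * ENK1 x) ∧ ENK1 x = EKK1 x := by
  have hτ : M1.IsFaithfulTrace τ := ⟨hτpos, hτfaith, hτtr⟩
  rintro x ⟨hx, hxM⟩
  have hd := hEKK1mem x hx
  have he := hENK1mem x hx
  have horth : ∀ y, (y ∈ K1 ∧ ∀ n ∈ N, y * n = n * y) → τ ((x - EKK1 x) * y) = 0 := by
    rintro y ⟨hy, -⟩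
    obtain ⟨w, hw, hwK, hwy⟩ := hτ.exists_commuting hKK1 hK1M1 hy
    have hz : x - EKK1 x ∈ M1 := sub_mem hx (hK1M1 _ hd.1)
    rw [← hτ.map_mul_eq_of_normalPart (fun k hk => hK1M1 k (hKK1 k hk)) (hK1M1 y hy) (hK1M1 w hw)
      hwy hz fun k hk => by rw [sub_mul, mul_sub, hxM k (hKM k hk), hd.2 k hk], sub_mul, map_sub,
      hEKK1 x hx w ⟨hw, hwK⟩, sub_self]
  have hdiff : ENK1 x - EKK1 x ∈ K1 := sub_mem he.1 hd.1
  have hcomm : ∀ n ∈ N, (ENK1 x - EKK1 x) * n = n * (ENK1 x - EKK1 x) := fun n hn => by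
    rw [sub_mul, mul_sub, he.2 n hn, hd.2 n (hNK n hn)]
  have hstar : ∀ n ∈ N, star (ENK1 x - EKK1 x) * n = n * star (ENK1 x - EKK1 x) := fun n hn => by
    have := congrArg star (hcomm (star n) (star_mem hn))
    rw [star_mul, star_mul, star_star] at this
    exact this.symm
  have hmem := And.intro (star_mem hdiff) hstar
  have heq : ENK1 x = EKK1 x := by
    refine sub_eq_zero.1 (hτ.eq_zero_of_mul_star (hK1M1 _ hdiff) ?_)
    have h1 := horth _ hmem
    have h2 := hENK1 x hx _ hmem
    rw [sub_mul, map_sub] at h1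
    rw [sub_mul, map_sub, h2, h1]
  exact ⟨heq ▸ hd, heq⟩
end
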